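/- arXiv:1904.13360 — 2 statements merged into one kernel-verified Lean document; each statement's English description precedes it below -/
import Mathlib

section
/- For all i ∈ {1, …, r} and s ≥ 0, P^{p*}_{σ'}-almost surely, k_{sn₀+1} ∈ B^i_{j_s} if and only if k₁ ∈ K_i. Consequently, B_{j_s} = (B¹_{j_s}, …, B^r_{j_s}) is a partition of the support of the law of k_{sn₀+1} under P^{p*}_{σ'}, and P^{p*}_{σ'}(k_{sn₀+1} ∈ B^i_{j_s}) = p*(K_i). -/
open MeasureTheory Filter

namespace PomdpPaper

/-- A belief (probability vector) on `Fin n`. -/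
def IsBelief {n : ℕ} (p : Fin n → ℝ) : Prop :=
  (∀ k, 0 ≤ p k) ∧ ∑ k, p k = 1

/-- The measure on a finite type associated with a probability vector. -/
noncomputable def vecMeasure {α : Type*} [Fintype α] [MeasurableSpace α] (p : α → ℝ) :
    Measure α :=
  ∑ x : α, ENNReal.ofReal (p x) • Measure.dirac x

/-- The Dirac belief at a point. -/
def diracBelief {n : ℕ} (k : Fin n) : Fin n → ℝ := fun k' => if k' = k then 1 else 0

/-- The `i`-th binary digit of a real number `x ∈ [0,1)` (as a real number `0` or `1`). -/
noncomputable def digitR (x : ℝ) (i : ℕ) : ℝ :=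
  if ⌊x * 2 ^ (i + 1)⌋ % 2 = 1 then 1 else 0

/-- From one uniform seed `x ∈ [0,1)`, a sequence `unif x 0, unif x 1, …` of
(independent, uniformly distributed on `[0,1]`) real numbers, obtained by splitting the
binary digits of `x` along the pairing function. -/
noncomputable def unif (x : ℝ) (m : ℕ) : ℝ :=
  ∑' j : ℕ, digitR x (Nat.pair m j) / 2 ^ (j + 1)

open Classical in
/-- Inverse-transform sampling from a probability vector on `Fin n` using a seed `u ∈ [0,1]`. -/
noncomputable def sampleFin {n : ℕ} (hn : 0 < n) (p : Fin n → ℝ) (u : ℝ) : Fin n :=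
  let s : Finset (Fin n) :=
    Finset.univ.filter fun y : Fin n => u < ∑ z ∈ Finset.univ.filter fun z : Fin n => z ≤ y, p z
  if hs : s.Nonempty then s.min' hs else ⟨0, hn⟩

/-- Inverse-transform sampling from a probability vector on a finite nonempty type. -/
noncomputable def sampleOn {β : Type*} [Fintype β] [Nonempty β] (p : β → ℝ) (u : ℝ) : β :=
  (Fintype.equivFin β).symm
    (sampleFin Fintype.card_pos (fun i => p ((Fintype.equivFin β).symm i)) u)

/-- A POMDP with states `Fin nK`, actions `Fin nA`, signals `Fin nS`, transition function `q`
and reward function `g` with values in `[0,1]`. -/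
structure POMDP where
  nK : ℕ
  nA : ℕ
  nS : ℕ
  hK : 0 < nK
  hA : 0 < nA
  hS : 0 < nS
  q : Fin nK → Fin nA → Fin nK × Fin nS → ℝ
  q_nonneg : ∀ k a y, 0 ≤ q k a y
  q_sum : ∀ k a, ∑ y, q k a y = 1
  g : Fin nK → Fin nA → ℝ
  g_nonneg : ∀ k a, 0 ≤ g k a
  g_le_one : ∀ k a, g k a ≤ 1

namespace POMDP

variable (Γ : POMDP)

/-- The state space. -/
abbrev K := Fin Γ.nK
/-- The action space. -/
abbrev A := Fin Γ.nA
/-- The signal space. -/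
abbrev S := Fin Γ.nS

instance : Nonempty Γ.K := ⟨⟨0, Γ.hK⟩⟩
instance : Nonempty Γ.A := ⟨⟨0, Γ.hA⟩⟩
instance : Nonempty Γ.S := ⟨⟨0, Γ.hS⟩⟩

/-- A history: the finite sequence of past actions and signals. -/
abbrev Hist := List (Γ.A × Γ.S)

/-- A (pure) strategy: a map from histories to actions. -/
abbrev Strategy := Γ.Hist → Γ.A

/-- The sample space carrying all the randomness: an initial state together with a
uniform seed in `[0,1)` used to draw all the transitions. -/
abbrev Env := Γ.K × ℝ

/-- The probability measure on the sample space induced by the initial belief `p1`: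
the initial state is drawn according to `p1`, the seed uniformly on `[0,1)`. -/
noncomputable def envMeasure (p1 : Γ.K → ℝ) : Measure Γ.Env :=
  (vecMeasure p1).prod (volume.restrict (Set.Ico (0 : ℝ) 1))

/-- The trajectory: `(Γ.traj σ ω m).1` is the state `k_{m+1}` at stage `m+1` and
`(Γ.traj σ ω m).2` is the history before stage `m+1` (of length `m`), when the
decision-maker uses strategy `σ` and the randomness is `ω`.  At each stage, the pair
(new state, signal) is drawn from `q` via inverse-transform sampling from a fresh
uniform variable. -/
noncomputable def traj (σ : Γ.Strategy) (ω : Γ.Env) : ℕ → Γ.K × Γ.Hist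
  | 0 => (ω.1, [])
  | m + 1 =>
    let p := traj σ ω m
    let a := σ p.2
    let y := sampleOn (Γ.q p.1 a) (unif ω.2 m)
    (y.1, p.2 ++ [(a, y.2)])

/-- The state `k_{m+1}` at stage `m+1` (`m` is 0-indexed). -/
noncomputable def state (σ : Γ.Strategy) (ω : Γ.Env) (m : ℕ) : Γ.K := (Γ.traj σ ω m).1

/-- The history before stage `m+1` (a list of length `m`). -/
noncomputable def hist (σ : Γ.Strategy) (ω : Γ.Env) (m : ℕ) : Γ.Hist := (Γ.traj σ ω m).2

/-- The action `a_{m+1}` played at stage `m+1`. -/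
noncomputable def act (σ : Γ.Strategy) (ω : Γ.Env) (m : ℕ) : Γ.A := σ (Γ.hist σ ω m)

/-- The reward `g_{m+1}` obtained at stage `m+1`. -/
noncomputable def rew (σ : Γ.Strategy) (ω : Γ.Env) (m : ℕ) : ℝ :=
  Γ.g (Γ.state σ ω m) (Γ.act σ ω m)

/-- The average reward over the first `n` stages. -/
noncomputable def avg (σ : Γ.Strategy) (ω : Γ.Env) (n : ℕ) : ℝ :=
  (1 / n : ℝ) * ∑ m ∈ Finset.range n, Γ.rew σ ω m

/-- The probability of an event under initial belief `p1` (the strategy `σ` is recorded for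
readability; the underlying measure does not depend on it). -/
noncomputable def prob (p1 : Γ.K → ℝ) (_σ : Γ.Strategy) (E : Set Γ.Env) : ℝ :=
  (Γ.envMeasure p1 E).toReal

/-- The long-run average payoff `γ^{p1}_∞(σ) = E[liminf (1/n) ∑ g_m]`. -/
noncomputable def pay (p1 : Γ.K → ℝ) (σ : Γ.Strategy) : ℝ :=
  ∫ ω, atTop.liminf (Γ.avg σ ω) ∂(Γ.envMeasure p1)

/-- The payoff starting from a deterministic state `k`, i.e. `γ^k_∞(σ)`. -/
noncomputable def payK (k : Γ.K) (σ : Γ.Strategy) : ℝ := Γ.pay (diracBelief k) σ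

/-- The value `v_∞(p1)`. -/
noncomputable def val (p1 : Γ.K → ℝ) : ℝ := ⨆ σ : Γ.Strategy, Γ.pay p1 σ

/-- A strategy has finite memory if it is implemented by a finite-state transducer. -/
def FiniteMemory (σ : Γ.Strategy) : Prop :=
  ∃ (n : ℕ) (m0 : Fin n) (σa : Fin n → Γ.A) (σu : Fin n → Γ.A × Γ.S → Fin n),
    ∀ h : Γ.Hist, σ h = σa (h.foldl σu m0)

/-- A blind MDP: the signal set is a singleton. -/
def Blind : Prop := Γ.nS = 1

/-- The strategy induced by a sequence of actions `a_1, a_2, …` (`as m` is the action played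
at stage `m+1`, regardless of the observed history). -/
def blindStrat (as : ℕ → Γ.A) : Γ.Strategy := fun h => as h.length

end POMDP

/-- A sequence is eventually periodic if it is periodic with some period `T ≥ 1` from
some stage `N` on. -/
def EventuallyPeriodic {α : Type*} (as : ℕ → α) : Prop :=
  ∃ T ≥ 1, ∃ N ≥ 1, ∀ m ≥ N, as (m + T) = as m


namespace POMDP

variable (Γ : POMDP)

/-- `Γ.histProb p1 σ h` is the probability, under initial belief `p1` and strategy `σ`,
that the history before stage `h.length + 1` equals `h`. -/
noncomputable def histProb (p1 : Γ.K → ℝ) (σ : Γ.Strategy) (h : Γ.Hist) : ℝ :=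
  Γ.prob p1 σ {ω | Γ.hist σ ω h.length = h}

/-- The belief at stage `h.length + 1` given the history `h`:
`p_m(k) = P(k_m = k | h_m = h)` (defined via Bayes rule, i.e. as a quotient). -/
noncomputable def belief (p1 : Γ.K → ℝ) (σ : Γ.Strategy) (h : Γ.Hist) : Γ.K → ℝ :=
  fun k =>
    Γ.prob p1 σ {ω | Γ.hist σ ω h.length = h ∧ Γ.state σ ω h.length = k} /
      Γ.histProb p1 σ h

end POMDP

namespace POMDP

variable (Γ : POMDP)

/-- The `h`-shift of a strategy: `σ[h](h') = σ(h, h')`. -/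
def shiftStrat (σ : Γ.Strategy) (h : Γ.Hist) : Γ.Strategy := fun h' => σ (h ++ h')

/-- `Γ.condStateProb k σ h k'` is the conditional probability
`P^k_σ(k_{m} = k' | h_m = h)` where `m = h.length + 1`. -/
noncomputable def condStateProb (k : Γ.K) (σ : Γ.Strategy) (h : Γ.Hist) (k' : Γ.K) : ℝ :=
  Γ.prob (diracBelief k) σ
      {ω | Γ.hist σ ω h.length = h ∧ Γ.state σ ω h.length = k'} /
    Γ.prob (diracBelief k) σ {ω | Γ.hist σ ω h.length = h}

/-- The super-support after history `h` associated with the classes `Kc`: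
`Γ.superSuppH σ Kc h i` is the set of states reached with positive probability after
history `h`, under `σ` and starting from a state in `Kc i`. -/
noncomputable def superSuppH (σ : Γ.Strategy) {r : ℕ} (Kc : Fin r → Finset Γ.K)
    (h : Γ.Hist) (i : Fin r) : Set Γ.K :=
  {k' | ∃ k ∈ Kc i, 0 < Γ.condStateProb k σ h k'}

end POMDP

open Classical in
/-- A representative history for a given super-support value: some history which has
positive probability under `σ` starting from `p*` and whose super-support equals `v`
(if such a history exists). -/
noncomputable def repHistOfVal (Γ : POMDP) (pstar : Γ.K → ℝ) (σ : Γ.Strategy) {r : ℕ}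
    (Kc : Fin r → Finset Γ.K) (v : Fin r → Set Γ.K) : Γ.Hist :=
  if hx : ∃ h : Γ.Hist, 0 < Γ.histProb pstar σ h ∧ Γ.superSuppH σ Kc h = v then
    hx.choose
  else []

/-- The representative history maintained after `s` complete blocks of length `n0`, given
the full observed history `h`: `blockRep … 0 h` represents the empty history, and the
representative after `s + 1` blocks is the representative of the super-support of
(previous representative ++ the `(s+1)`-st block of `h`). -/
noncomputable def blockRep (Γ : POMDP) (pstar : Γ.K → ℝ) (σ : Γ.Strategy) {r : ℕ}
    (Kc : Fin r → Finset Γ.K) (n0 : ℕ) : ℕ → Γ.Hist → Γ.Hist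
  | 0, _ => repHistOfVal Γ pstar σ Kc (Γ.superSuppH σ Kc [])
  | s + 1, h =>
    repHistOfVal Γ pstar σ Kc
      (Γ.superSuppH σ Kc
        (blockRep Γ pstar σ Kc n0 s h ++ (h.drop (s * n0)).take n0))

/-- The finite-memory strategy `σ'`: during the block of stages `s·n0 + 1, …, (s+1)·n0`,
play as `σ` would play after the maintained representative history followed by the
history collected since stage `s·n0 + 1`. -/
noncomputable def pomdpSigma' (Γ : POMDP) (pstar : Γ.K → ℝ) (σ : Γ.Strategy) {r : ℕ}
    (Kc : Fin r → Finset Γ.K) (n0 : ℕ) : Γ.Strategy :=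
  fun h =>
    σ (blockRep Γ pstar σ Kc n0 (h.length / n0) h ++ h.drop (h.length / n0 * n0))


/-- Uniform probability on the seed. -/
noncomputable def seedP : Measure ℝ := volume.restrict (Set.Ico (0 : ℝ) 1)

instance : IsProbabilityMeasure seedP := ⟨by simp [seedP]⟩

lemma digitR_mem (x : ℝ) (i : ℕ) : digitR x i = 0 ∨ digitR x i = 1 := by
  unfold digitR; split_ifs <;> simp

lemma digitR_nonneg (x : ℝ) (i : ℕ) : 0 ≤ digitR x i := by
  rcases digitR_mem x i with h | h <;> simp [h]

lemma digitR_le_one (x : ℝ) (i : ℕ) : digitR x i ≤ 1 := by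
  rcases digitR_mem x i with h | h <;> simp [h]

lemma digitR_succ (x : ℝ) (i : ℕ) : digitR x (i + 1) = digitR (2 * x) i := by
  unfold digitR
  have : x * 2 ^ (i + 1 + 1) = 2 * x * 2 ^ (i + 1) := by ring
  rw [this]

lemma digitR_sub_one (x : ℝ) (i : ℕ) : digitR (x - 1) i = digitR x i := by
  unfold digitR
  have : (x - 1) * 2 ^ (i + 1) = x * 2 ^ (i + 1) - ((2 * 2 ^ i : ℤ) : ℝ) := by
    push_cast; ring
  rw [this, Int.floor_sub_intCast, Int.sub_mul_emod_self_left]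

lemma digitR_zero_lo {x : ℝ} (h0 : 0 ≤ x) (h1 : 2 * x < 1) : digitR x 0 = 0 := by
  unfold digitR
  have : ⌊x * 2 ^ (0 + 1)⌋ = 0 := by
    rw [Int.floor_eq_iff]; constructor <;> norm_num <;> linarith
  rw [this]; norm_num

lemma digitR_zero_hi {x : ℝ} (h0 : 1 ≤ 2 * x) (h1 : x < 1) : digitR x 0 = 1 := by
  unfold digitR
  have : ⌊x * 2 ^ (0 + 1)⌋ = 1 := by
    rw [Int.floor_eq_iff]; constructor <;> norm_num <;> linarith
  rw [this]; norm_num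

lemma digitR_measurable (i : ℕ) : Measurable fun x => digitR x i := by
  unfold digitR
  refine Measurable.ite ?_ measurable_const measurable_const
  have : Measurable fun x : ℝ => ⌊x * 2 ^ (i + 1)⌋ := by fun_prop
  exact this (MeasurableSet.of_discrete (s := {z : ℤ | z % 2 = 1}))

open Classical in
/-- half the number of digits in `t` -/
noncomputable def dmass (t : Set ℝ) : ENNReal :=
  ((if (0 : ℝ) ∈ t then 1 else 0) + (if (1 : ℝ) ∈ t then 1 else 0)) * 2⁻¹

/-- the event that the first `n` digits lie in `t` -/
def digEv (n : ℕ) (t : ℕ → Set ℝ) : Set ℝ :=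
  {x | x ∈ Set.Ico (0 : ℝ) 1 ∧ ∀ i < n, digitR x i ∈ t i}

lemma digEv_meas (n : ℕ) (t : ℕ → Set ℝ) (ht : ∀ i, MeasurableSet (t i)) :
    MeasurableSet (digEv n t) := by
  unfold digEv
  refine measurableSet_Ico.inter ?_
  have : {x : ℝ | ∀ i < n, digitR x i ∈ t i} = ⋂ i, ⋂ (_ : i < n), (fun x => digitR x i) ⁻¹' t i := by
    ext; simp
  change MeasurableSet {x : ℝ | ∀ i < n, digitR x i ∈ t i}
  rw [this]
  exact MeasurableSet.iInter fun i => MeasurableSet.iInter fun _ => digitR_measurable i (ht i)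

lemma digEv_vol (n : ℕ) : ∀ (t : ℕ → Set ℝ), (∀ i, MeasurableSet (t i)) →
    volume (digEv n t) = ∏ i ∈ Finset.range n, dmass (t i) := by
  induction n with
  | zero =>
    intro t _
    have : digEv 0 t = Set.Ico (0 : ℝ) 1 := by ext; simp [digEv]
    rw [this]; simp
  | succ n ih =>
    intro t ht
    classical
    set F := digEv n (fun i => t (i + 1)) with hF
    have hFm : MeasurableSet F := digEv_meas _ _ fun i => ht _
    have hFv := ih (fun i => t (i + 1)) fun i => ht _
    set L : Set ℝ := (fun x => 2 * x) ⁻¹' F with hL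
    set R : Set ℝ := (fun x => 2 * x) ⁻¹' ((fun x => x + (-1)) ⁻¹' F) with hR
    have hLv : volume L = 2⁻¹ * volume F := by
      rw [hL, Real.volume_preimage_mul_left (by norm_num)]
      congr 1
      rw [abs_of_pos (by norm_num), ENNReal.ofReal_inv_of_pos (by norm_num)]; simp
    have hRv : volume R = 2⁻¹ * volume F := by
      rw [hR, Real.volume_preimage_mul_left (by norm_num), measure_preimage_add_right]
      congr 1
      rw [abs_of_pos (by norm_num), ENNReal.ofReal_inv_of_pos (by norm_num)]; simp
    have hRm : MeasurableSet R := by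
      have : Measurable fun x : ℝ => 2 * x + (-1) := by fun_prop
      exact this hFm
    have hdisj : Disjoint L R := by
      rw [Set.disjoint_left]
      rintro x ⟨⟨a, b⟩, _⟩ ⟨⟨c, d⟩, _⟩
      simp only at a b c d
      linarith
    have key : digEv (n + 1) t =
        (if (0 : ℝ) ∈ t 0 then L else ∅) ∪ (if (1 : ℝ) ∈ t 0 then R else ∅) := by
      ext x
      have hsplit : (∀ i < n + 1, digitR x i ∈ t i) ↔
          digitR x 0 ∈ t 0 ∧ ∀ i < n, digitR (2 * x) i ∈ t (i + 1) := by
        constructor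
        · intro h
          refine ⟨h 0 (by omega), fun i hi => ?_⟩
          rw [← digitR_succ]; exact h (i + 1) (by omega)
        · rintro ⟨h0, h⟩ i hi
          cases i with
          | zero => exact h0
          | succ i => rw [digitR_succ]; exact h i (by omega)
      have hLx : x ∈ L ↔ (0 ≤ x ∧ 2 * x < 1) ∧ ∀ i < n, digitR (2 * x) i ∈ t (i + 1) := by
        simp only [hL, hF, digEv, Set.mem_preimage, Set.mem_ofPred_eq, Set.mem_Ico]
        constructor
        · rintro ⟨⟨a, b⟩, c⟩; exact ⟨⟨by linarith, b⟩, c⟩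
        · rintro ⟨⟨a, b⟩, c⟩; exact ⟨⟨by linarith, b⟩, c⟩
      have hRx : x ∈ R ↔ (1 ≤ 2 * x ∧ x < 1) ∧ ∀ i < n, digitR (2 * x) i ∈ t (i + 1) := by
        simp only [hR, hF, digEv, Set.mem_preimage, Set.mem_ofPred_eq, Set.mem_Ico,
          ← sub_eq_add_neg, digitR_sub_one]
        constructor
        · rintro ⟨⟨a, b⟩, c⟩; exact ⟨⟨by linarith, by linarith⟩, c⟩
        · rintro ⟨⟨a, b⟩, c⟩; exact ⟨⟨by linarith, by linarith⟩, c⟩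
      have e1 : x ∈ digEv (n + 1) t ↔ (0 ≤ x ∧ x < 1) ∧ digitR x 0 ∈ t 0 ∧
          ∀ i < n, digitR (2 * x) i ∈ t (i + 1) := by
        rw [← hsplit]; rfl
      rw [e1]
      have e2 : x ∈ (if (0 : ℝ) ∈ t 0 then L else ∅) ↔ (0 : ℝ) ∈ t 0 ∧ x ∈ L := by
        split_ifs with h <;> simp [h]
      have e3 : x ∈ (if (1 : ℝ) ∈ t 0 then R else ∅) ↔ (1 : ℝ) ∈ t 0 ∧ x ∈ R := by
        split_ifs with h <;> simp [h]
      rw [Set.mem_union, e2, e3, hLx, hRx]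
      constructor
      · rintro ⟨⟨a, b⟩, c, d⟩
        by_cases hx : 2 * x < 1
        · left; rw [digitR_zero_lo a hx] at c; exact ⟨c, ⟨a, hx⟩, d⟩
        · right; rw [digitR_zero_hi (not_lt.mp hx) b] at c; exact ⟨c, ⟨not_lt.mp hx, b⟩, d⟩
      · rintro (⟨c, ⟨a, b⟩, d⟩ | ⟨c, ⟨a, b⟩, d⟩)
        · exact ⟨⟨a, by linarith⟩, by rw [digitR_zero_lo a b]; exact c, d⟩
        · exact ⟨⟨by linarith, b⟩, by rw [digitR_zero_hi a b]; exact c, d⟩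
    rw [key, Finset.prod_range_succ', ← hFv, dmass]
    by_cases h0 : (0 : ℝ) ∈ t 0 <;> by_cases h1 : (1 : ℝ) ∈ t 0 <;> simp only [h0, h1, if_true, if_false]
    · rw [measure_union hdisj hRm, hLv, hRv]; ring
    · rw [Set.union_empty, hLv, add_zero, one_mul, mul_comm]
    · rw [Set.empty_union, hRv, zero_add, one_mul, mul_comm]
    · simp

lemma dmass_univ : dmass Set.univ = 1 := by
  simp [dmass, one_add_one_eq_two, ENNReal.mul_inv_cancel]

lemma seedP_digits (S : Finset ℕ) (t : ℕ → Set ℝ) (ht : ∀ i ∈ S, MeasurableSet (t i)) :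
    seedP (⋂ i ∈ S, (fun x => digitR x i) ⁻¹' t i) = ∏ i ∈ S, dmass (t i) := by
  classical
  obtain ⟨n, hn⟩ := S.exists_nat_subset_range
  set t' : ℕ → Set ℝ := fun i => if i ∈ S then t i else Set.univ with ht'
  have h := digEv_vol n t' (fun i => by
    simp only [ht']; split_ifs with h
    · exact ht i h
    · exact MeasurableSet.univ)
  have e : ∏ i ∈ S, dmass (t i) = ∏ i ∈ Finset.range n, dmass (t' i) := by
    rw [← Finset.prod_subset hn]
    · exact Finset.prod_congr rfl fun i hi => by simp [ht', hi]
    · intro i _ hi; simp [ht', hi, dmass_univ]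
  rw [e, ← h, seedP, Measure.restrict_apply]
  · congr 1
    ext x
    simp only [digEv, Set.mem_inter_iff, Set.mem_iInter, Set.mem_preimage, Set.mem_ofPred_eq, ht']
    constructor
    · rintro ⟨a, b⟩
      refine ⟨b, fun i _ => ?_⟩
      split_ifs with hi
      · exact a i hi
      · trivial
    · rintro ⟨b, a⟩
      refine ⟨fun i hi => ?_, b⟩
      have := a i (Finset.mem_range.mp (hn hi))
      simpa [hi] using this
  · exact S.measurableSet_biInter fun i hi => digitR_measurable i (ht i hi)

lemma digits_iIndep : ProbabilityTheory.iIndepFun (fun i x => digitR x i) seedP := by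
  rw [ProbabilityTheory.iIndepFun_iff_measure_inter_preimage_eq_mul]
  intro S t ht
  rw [seedP_digits S t ht]
  refine Finset.prod_congr rfl fun i hi => ?_
  have := seedP_digits {i} t (fun j hj => by
    rw [Finset.mem_singleton] at hj; subst hj; exact ht _ hi)
  simpa using this.symm

/-- the sigma-algebra generated by the uniform variables with index in `J` -/
@[reducible] noncomputable def sigJ (J : Set ℕ) : MeasurableSpace ℝ :=
  ⨆ n ∈ {n : ℕ | (Nat.unpair n).1 ∈ J}, MeasurableSpace.comap (fun x => digitR x n) inferInstance

lemma sigJ_indep {J J' : Set ℕ} (h : Disjoint J J') :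
    ProbabilityTheory.Indep (sigJ J) (sigJ J') seedP := by
  refine ProbabilityTheory.indep_iSup_of_disjoint (fun i => (digitR_measurable i).comap_le)
    ((ProbabilityTheory.iIndepFun_iff_iIndep _ _ _).1 digits_iIndep) ?_
  rw [Set.disjoint_left] at h ⊢
  intro n hn hn'
  exact h hn hn'

lemma sigJ_le (J : Set ℕ) : sigJ J ≤ (inferInstance : MeasurableSpace ℝ) :=
  iSup₂_le fun i _ => (digitR_measurable i).comap_le

lemma unif_term_nonneg (x : ℝ) (m j : ℕ) : 0 ≤ digitR x (Nat.pair m j) / 2 ^ (j + 1) :=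
  div_nonneg (digitR_nonneg _ _) (by positivity)

lemma unif_term_le (x : ℝ) (m j : ℕ) :
    digitR x (Nat.pair m j) / 2 ^ (j + 1) ≤ 1 / 2 ^ (j + 1) := by
  gcongr; exact digitR_le_one _ _

lemma hasSum_geo : HasSum (fun j : ℕ => (1 : ℝ) / 2 ^ (j + 1)) 1 := by
  convert hasSum_geometric_two' 1 using 2 with n
  rw [pow_succ, div_div, mul_comm]

lemma unif_summable (x : ℝ) (m : ℕ) :
    Summable fun j : ℕ => digitR x (Nat.pair m j) / 2 ^ (j + 1) :=
  Summable.of_nonneg_of_le (unif_term_nonneg x m) (unif_term_le x m) hasSum_geo.summable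

lemma series_measurable {α : Type*} [MeasurableSpace α] (D : ℕ → α → ℝ)
    (hD : ∀ j, Measurable (D j)) (hs : ∀ x, Summable fun j => D j x / 2 ^ (j + 1)) :
    Measurable fun x => ∑' j : ℕ, D j x / 2 ^ (j + 1) := by
  refine measurable_of_tendsto_metrizable
    (f := fun n x => ∑ j ∈ Finset.range n, D j x / 2 ^ (j + 1)) ?_ ?_
  · intro n
    exact Finset.measurable_fun_sum _ fun j _ => (hD j).div_const _
  · rw [tendsto_pi_nhds]
    intro x
    exact (hs x).hasSum.tendsto_sum_nat

lemma unif_measurable {J : Set ℕ} {m : ℕ} (hm : m ∈ J) :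
    Measurable[sigJ J] fun x => unif x m := by
  have h1 : ∀ j, Measurable[sigJ J] fun x => digitR x (Nat.pair m j) := by
    intro j
    refine Measurable.mono (comap_measurable (fun x => digitR x (Nat.pair m j))) ?_ le_rfl
    exact le_iSup₂_of_le (f := fun n (_ : n ∈ {n : ℕ | (Nat.unpair n).1 ∈ J}) =>
      MeasurableSpace.comap (fun x => digitR x n) inferInstance) (Nat.pair m j)
      (by simpa using hm) le_rfl
  exact @series_measurable ℝ (sigJ J) (fun j x => digitR x (Nat.pair m j)) h1
    (fun x => unif_summable x m)

lemma unif_nonneg (x : ℝ) (m : ℕ) : 0 ≤ unif x m := tsum_nonneg (unif_term_nonneg x m)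

lemma unif_lt_one {x : ℝ} {m j : ℕ} (h : digitR x (Nat.pair m j) = 0) : unif x m < 1 := by
  rw [← hasSum_geo.tsum_eq]
  refine Summable.tsum_lt_tsum (i := j) (unif_term_le x m) ?_ (unif_summable x m)
    hasSum_geo.summable
  rw [h]; simp

lemma dmass_singleton {c : ℝ} (h : c = 0 ∨ c = 1) : dmass {c} = 2⁻¹ := by
  rcases h with rfl | rfl <;> simp [dmass]

lemma seedP_unif_digits (m l : ℕ) (d : ℕ → ℝ) (hd : ∀ j, d j = 0 ∨ d j = 1) :
    seedP {x | ∀ j < l, digitR x (Nat.pair m j) = d j} = 2⁻¹ ^ l := by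
  classical
  have h := seedP_digits ((Finset.range l).image (Nat.pair m))
    (fun n => {d (Nat.unpair n).2}) (fun i _ => MeasurableSet.singleton _)
  have inj : Function.Injective (Nat.pair m) := fun a b hab => (Nat.pair_eq_pair.mp hab).2
  rw [Finset.prod_image inj.injOn] at h
  simp only [Nat.unpair_pair, dmass_singleton (hd _), Finset.prod_const, Finset.card_range] at h
  rw [← h]
  congr 1
  ext x
  simp

lemma unif_ae_lt_one (m : ℕ) : ∀ᵐ x ∂seedP, unif x m < 1 := by
  rw [ae_iff]
  have hle : ∀ l : ℕ, seedP {x | ¬ unif x m < 1} ≤ 2⁻¹ ^ l := by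
    intro l
    rw [← seedP_unif_digits m l (fun _ => 1) (fun _ => Or.inr rfl)]
    refine measure_mono fun x hx j _ => ?_
    rcases digitR_mem x (Nat.pair m j) with h | h
    · exact absurd (unif_lt_one h) hx
    · exact h
  have ht : Tendsto (fun l : ℕ => (2⁻¹ : ENNReal) ^ l) atTop (nhds 0) :=
    ENNReal.tendsto_pow_atTop_nhds_zero_of_lt_one (by simp)
  exact le_antisymm (ge_of_tendsto' ht hle) bot_le

lemma unif_tail (x : ℝ) (m l : ℕ) :
    ∑ j ∈ Finset.range l, digitR x (Nat.pair m j) / 2 ^ (j + 1) ≤ unif x m ∧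
    unif x m ≤ ∑ j ∈ Finset.range l, digitR x (Nat.pair m j) / 2 ^ (j + 1) + 1 / 2 ^ l := by
  have hs := (unif_summable x m).sum_add_tsum_nat_add l
  have hs' := (summable_nat_add_iff l).mpr (unif_summable x m)
  have h0 : 0 ≤ ∑' j, digitR x (Nat.pair m (j + l)) / 2 ^ (j + l + 1) :=
    tsum_nonneg fun j => unif_term_nonneg x m (j + l)
  have h2 : HasSum (fun j : ℕ => (1 : ℝ) / 2 ^ (j + l + 1)) (1 / 2 ^ l) := by
    have h := hasSum_geo.mul_right (1 / 2 ^ l : ℝ)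
    rw [one_mul] at h
    have e : (fun j : ℕ => (1 : ℝ) / 2 ^ (j + l + 1)) =
        fun j : ℕ => (1 : ℝ) / 2 ^ (j + 1) * (1 / 2 ^ l) := by
      funext j
      rw [div_mul_div_comm, ← pow_add, one_mul]
      congr 2; ring
    rw [e]; exact h
  have h1 : ∑' j, digitR x (Nat.pair m (j + l)) / 2 ^ (j + l + 1) ≤ 1 / 2 ^ l := by
    rw [← h2.tsum_eq]
    exact hs'.tsum_le_tsum (fun j => unif_term_le x m (j + l)) h2.summable
  unfold unif
  constructor <;> linarith

lemma digit_partial (c : ℝ) (h0 : 0 ≤ c) (h1 : c < 1) (l : ℕ) :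
    ∑ j ∈ Finset.range l, digitR c j / 2 ^ (j + 1) = ⌊c * 2 ^ l⌋ / 2 ^ l := by
  induction l with
  | zero =>
    have : ⌊c⌋ = 0 := by rw [Int.floor_eq_iff]; constructor <;> norm_num <;> linarith
    simp [this]
  | succ l ih =>
    rw [Finset.sum_range_succ, ih]
    have hf : ⌊c * 2 ^ l⌋ = ⌊c * 2 ^ (l + 1)⌋ / 2 := by
      have := Int.floor_div_natCast (c * 2 ^ (l + 1)) 2
      rw [← Nat.cast_ofNat (R := ℤ), ← this]
      congr 1
      rw [pow_succ]; push_cast; field_simp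
    have hd : digitR c l = ((⌊c * 2 ^ (l + 1)⌋ % 2 : ℤ) : ℝ) := by
      unfold digitR
      split_ifs with h
      · rw [h]; simp
      · have : ⌊c * 2 ^ (l + 1)⌋ % 2 = 0 := by omega
        rw [this]; simp
    have hz : ((2 * (⌊c * 2 ^ (l + 1)⌋ / 2) + ⌊c * 2 ^ (l + 1)⌋ % 2 : ℤ) : ℝ) =
        (⌊c * 2 ^ (l + 1)⌋ : ℤ) := by
      congr 1; omega
    rw [hd, hf, ← hz]
    push_cast
    rw [pow_succ]
    field_simp

lemma unif_Ico_pos (m : ℕ) {a b : ℝ} (ha : 0 ≤ a) (hab : a < b) (hb : b ≤ 1) :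
    0 < seedP {x | a ≤ unif x m ∧ unif x m < b} := by
  set c := (a + b) / 2 with hc
  obtain ⟨l, hl⟩ : ∃ l : ℕ, (1 / 2 : ℝ) ^ l < (b - a) / 2 :=
    exists_pow_lt_of_lt_one (by linarith) (by norm_num)
  have hlt : (1 : ℝ) / 2 ^ l < (b - a) / 2 := by rwa [one_div_pow] at hl
  have h := seedP_unif_digits m l (digitR c) (digitR_mem c)
  have hpos : (0 : ENNReal) < 2⁻¹ ^ l := ENNReal.pow_pos (by simp) _
  rw [← h] at hpos
  refine hpos.trans_le (measure_mono fun x hx => ?_)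
  have hsum : ∑ j ∈ Finset.range l, digitR x (Nat.pair m j) / 2 ^ (j + 1) =
      ⌊c * 2 ^ l⌋ / 2 ^ l := by
    rw [← digit_partial c (by linarith) (by linarith) l]
    exact Finset.sum_congr rfl fun j hj => by rw [hx j (Finset.mem_range.mp hj)]
  have ht := unif_tail x m l
  rw [hsum] at ht
  have p2 : (0 : ℝ) < 2 ^ l := by positivity
  have f1 : (⌊c * 2 ^ l⌋ : ℝ) / 2 ^ l ≤ c := by
    rw [div_le_iff₀ p2]; exact Int.floor_le _
  have f2 : c < (⌊c * 2 ^ l⌋ : ℝ) / 2 ^ l + 1 / 2 ^ l := by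
    rw [← add_div, lt_div_iff₀ p2]; exact Int.lt_floor_add_one _
  constructor <;> linarith [ht.1, ht.2]

lemma sum_le_eq {n : ℕ} (p : Fin n → ℝ) (y : Fin n) :
    ∑ z ∈ Finset.univ.filter (fun z : Fin n => z ≤ y), p z =
      ∑ z ∈ Finset.univ.filter (fun z : Fin n => z < y), p z + p y := by
  classical
  have : Finset.univ.filter (fun z : Fin n => z ≤ y) =
      insert y (Finset.univ.filter (fun z : Fin n => z < y)) := by
    ext z; simp [le_iff_eq_or_lt]
  rw [this, Finset.sum_insert (by simp), add_comm]

lemma sampleFin_eq {n : ℕ} (hn : 0 < n) (p : Fin n → ℝ) (hp : ∀ z, 0 ≤ p z) (u : ℝ) (y : Fin n)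
    (h1 : ∑ z ∈ Finset.univ.filter (fun z : Fin n => z < y), p z ≤ u)
    (h2 : u < ∑ z ∈ Finset.univ.filter (fun z : Fin n => z ≤ y), p z) :
    sampleFin hn p u = y := by
  classical
  unfold sampleFin
  have hy : y ∈ Finset.univ.filter (fun y : Fin n =>
      u < ∑ z ∈ Finset.univ.filter (fun z : Fin n => z ≤ y), p z) := by
    rw [Finset.mem_filter]; exact ⟨Finset.mem_univ _, h2⟩
  simp only
  rw [dif_pos ⟨y, by convert hy⟩]
  refine le_antisymm (Finset.min'_le _ _ (by convert hy)) ?_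
  refine Finset.le_min' _ _ _ fun w hw => ?_
  by_contra hlt
  have hw2 : u < ∑ z ∈ Finset.univ.filter (fun z : Fin n => z ≤ w), p z := by
    have := (Finset.mem_filter.mp hw).2
    convert this
  have : ∑ z ∈ Finset.univ.filter (fun z : Fin n => z ≤ w), p z ≤
      ∑ z ∈ Finset.univ.filter (fun z : Fin n => z < y), p z := by
    refine Finset.sum_le_sum_of_subset_of_nonneg ?_ fun z _ _ => hp z
    intro z hz
    rw [Finset.mem_filter] at hz ⊢
    exact ⟨hz.1, lt_of_le_of_lt hz.2 (not_le.mp hlt)⟩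
  linarith

lemma sampleFin_pos {n : ℕ} (hn : 0 < n) (p : Fin n → ℝ) (hp : ∀ z, 0 ≤ p z)
    (hs : ∑ z, p z = 1) (u : ℝ) (h0 : 0 ≤ u) (h1 : u < 1) : 0 < p (sampleFin hn p u) := by
  classical
  -- find the least index whose cumulative sum exceeds `u`
  have hex : ∃ y : ℕ, ∃ hy : y < n,
      u < ∑ z ∈ Finset.univ.filter (fun z : Fin n => z ≤ ⟨y, hy⟩), p z := by
    refine ⟨n - 1, by omega, ?_⟩
    have : Finset.univ.filter (fun z : Fin n => z ≤ ⟨n - 1, by omega⟩) = Finset.univ := by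
      ext z; simp [Fin.le_def]; omega
    rw [this, hs]; exact h1
  obtain ⟨hy, hu⟩ := Nat.find_spec hex
  set y := Nat.find hex with hydef
  have hlow : ∑ z ∈ Finset.univ.filter (fun z : Fin n => z < ⟨y, hy⟩), p z ≤ u := by
    rcases Nat.eq_zero_or_pos y with h | h
    · have : Finset.univ.filter (fun z : Fin n => z < ⟨y, hy⟩) = ∅ := by
        ext z; simp [Fin.lt_def]; omega
      rw [this]; simpa using h0
    · have hm := Nat.find_min hex (m := y - 1) (by omega)
      push Not at hm
      have := hm (by omega)
      have e : Finset.univ.filter (fun z : Fin n => z < ⟨y, hy⟩) =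
          Finset.univ.filter (fun z : Fin n => z ≤ ⟨y - 1, by omega⟩) := by
        ext z; simp [Fin.lt_def, Fin.le_def]; omega
      rw [e]; exact this
  rw [sampleFin_eq hn p hp u ⟨y, hy⟩ hlow hu]
  rw [sum_le_eq] at hu
  linarith

lemma sampleFin_meas {n : ℕ} (hn : 0 < n) (p : Fin n → ℝ) : Measurable (sampleFin hn p) := by
  classical
  have h1 : Measurable fun (u : ℝ) (y : Fin n) =>
      decide (u < ∑ z ∈ Finset.univ.filter (fun z : Fin n => z ≤ y), p z) := by
    refine measurable_pi_lambda _ fun y => ?_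
    refine measurable_to_bool ?_
    have : (fun u : ℝ => decide (u < ∑ z ∈ Finset.univ.filter (fun z : Fin n => z ≤ y), p z)) ⁻¹'
        {true} = Set.Iio (∑ z ∈ Finset.univ.filter (fun z : Fin n => z ≤ y), p z) := by
      ext u; simp
    rw [this]; exact measurableSet_Iio
  have h2 : Measurable fun (b : Fin n → Bool) =>
      (if hs : (Finset.univ.filter fun y : Fin n => b y = true).Nonempty then
        (Finset.univ.filter fun y : Fin n => b y = true).min' hs else (⟨0, hn⟩ : Fin n)) :=
    measurable_of_finite _
  convert h2.comp h1 using 1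
  funext u
  simp only [sampleFin, Function.comp, decide_eq_true_eq]

lemma sampleOn_meas {β : Type*} [Fintype β] [Nonempty β] (p : β → ℝ) (T : Set β) :
    MeasurableSet {u | sampleOn p u ∈ T} := by
  have := sampleFin_meas (n := Fintype.card β) Fintype.card_pos
    (fun i => p ((Fintype.equivFin β).symm i))
  exact this (MeasurableSet.of_discrete (s := (Fintype.equivFin β).symm ⁻¹' T))

lemma sampleOn_pos {β : Type*} [Fintype β] [Nonempty β] (p : β → ℝ) (hp : ∀ z, 0 ≤ p z)
    (hs : ∑ z, p z = 1) (u : ℝ) (h0 : 0 ≤ u) (h1 : u < 1) : 0 < p (sampleOn p u) := by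
  refine sampleFin_pos (n := Fintype.card β) Fintype.card_pos
    (fun i => p ((Fintype.equivFin β).symm i)) (fun z => hp _) ?_ u h0 h1
  rw [← hs]
  exact Equiv.sum_comp (Fintype.equivFin β).symm p

lemma sampleOn_prob {β : Type*} [Fintype β] [Nonempty β] (p : β → ℝ) (hp : ∀ z, 0 ≤ p z)
    (hs : ∑ z, p z = 1) (y : β) (hy : 0 < p y) (m : ℕ) :
    0 < seedP {x | sampleOn p (unif x m) = y} := by
  set p' : Fin (Fintype.card β) → ℝ := fun i => p ((Fintype.equivFin β).symm i) with hp'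
  set y' := Fintype.equivFin β y with hy'
  have hs' : ∑ z, p' z = 1 := by
    rw [← hs]; exact Equiv.sum_comp (Fintype.equivFin β).symm p
  have hpy : p' y' = p y := by simp [hp', hy']
  have hnn : ∀ z, 0 ≤ p' z := fun z => hp _
  have h := unif_Ico_pos m
    (a := ∑ z ∈ Finset.univ.filter (fun z => z < y'), p' z)
    (b := ∑ z ∈ Finset.univ.filter (fun z => z ≤ y'), p' z)
    (Finset.sum_nonneg fun z _ => hnn z)
    (by rw [sum_le_eq]; linarith)
    (by rw [← hs']; exact Finset.sum_le_sum_of_subset_of_nonneg (Finset.subset_univ _)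
          fun z _ _ => hnn z)
  refine h.trans_le (measure_mono fun x hx => ?_)
  change (Fintype.equivFin β).symm (sampleFin _ p' (unif x m)) = y
  rw [sampleFin_eq _ p' hnn _ y' hx.1 hx.2]
  simp [hy']

namespace POMDP

variable (Γ : POMDP)

lemma envMeasure_apply (p : Γ.K → ℝ) (E : Set Γ.Env) :
    Γ.envMeasure p E = ∑ k, ENNReal.ofReal (p k) * seedP {x | (k, x) ∈ E} := by
  have key : ∀ s : Finset Γ.K,
      (∑ x ∈ s, ENNReal.ofReal (p x) • Measure.dirac x : Measure Γ.K).prod seedP =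
      ∑ x ∈ s, ENNReal.ofReal (p x) • Measure.map (Prod.mk x) seedP := by
    classical
    intro s
    induction s using Finset.induction_on with
    | empty => simp
    | insert a s ha ih =>
      have : SFinite (∑ x ∈ s, ENNReal.ofReal (p x) • Measure.dirac x : Measure Γ.K) := by
        infer_instance
      rw [Finset.sum_insert ha, Finset.sum_insert ha, Measure.add_prod, ih,
        Measure.prod_smul_left, Measure.dirac_prod]
  have hemb : ∀ k : Γ.K, MeasurableEmbedding (Prod.mk k : ℝ → Γ.Env) := fun k =>
    MeasurableEmbedding.prodMk_left k MeasurableEmbedding.id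
  change ((∑ x : Γ.K, ENNReal.ofReal (p x) • Measure.dirac x : Measure Γ.K).prod seedP) E = _
  rw [key]
  simp only [Measure.coe_finsetSum, Finset.sum_apply, Measure.smul_apply, smul_eq_mul]
  refine Finset.sum_congr rfl fun k _ => ?_
  rw [(hemb k).map_apply]; rfl

lemma envMeasure_dirac (k : Γ.K) (E : Set Γ.Env) :
    Γ.envMeasure (diracBelief k) E = seedP {x | (k, x) ∈ E} := by
  rw [envMeasure_apply, Finset.sum_eq_single k]
  · simp [diracBelief]
  · intro b _ hb; simp [diracBelief, hb]
  · simp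

lemma envMeasure_prob (p : Γ.K → ℝ) (hp : IsBelief p) : IsProbabilityMeasure (Γ.envMeasure p) := by
  constructor
  rw [envMeasure_apply]
  simp only [Set.mem_univ]
  have : seedP {x : ℝ | True} = 1 := measure_univ (μ := seedP)
  simp only [this, mul_one]
  rw [← ENNReal.ofReal_sum_of_nonneg fun k _ => hp.1 k, hp.2, ENNReal.ofReal_one]

lemma ae_env (p : Γ.K → ℝ) (Q : Γ.Env → Prop)
    (h : ∀ k, 0 < p k → ∀ᵐ x ∂seedP, Q (k, x)) : ∀ᵐ ω ∂(Γ.envMeasure p), Q ω := by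
  rw [ae_iff, envMeasure_apply]
  refine Finset.sum_eq_zero fun k _ => ?_
  rcases le_or_gt (p k) 0 with hk | hk
  · rw [ENNReal.ofReal_of_nonpos hk, zero_mul]
  · have := h k hk
    rw [ae_iff] at this
    have e : seedP {x | (k, x) ∈ {a | ¬ Q a}} = 0 := this
    rw [e, mul_zero]

/-- one step of the trajectory -/
noncomputable def stp (σ : Γ.Strategy) (p : Γ.K × Γ.Hist) (u : ℝ) : Γ.K × Γ.Hist :=
  ((sampleOn (Γ.q p.1 (σ p.2)) u).1, p.2 ++ [(σ p.2, (sampleOn (Γ.q p.1 (σ p.2)) u).2)])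

/-- trajectory started at `p0` at time `m` -/
noncomputable def gtraj (σ : Γ.Strategy) (p0 : Γ.K × Γ.Hist) (m : ℕ) (x : ℝ) :
    ℕ → Γ.K × Γ.Hist
  | 0 => p0
  | n + 1 => Γ.stp σ (gtraj σ p0 m x n) (unif x (m + n))

lemma traj_succ (σ : Γ.Strategy) (ω : Γ.Env) (m : ℕ) :
    Γ.traj σ ω (m + 1) = Γ.stp σ (Γ.traj σ ω m) (unif ω.2 m) := rfl

lemma traj_add (σ : Γ.Strategy) (k : Γ.K) (x : ℝ) (m n : ℕ) :
    Γ.traj σ (k, x) (m + n) = Γ.gtraj σ (Γ.traj σ (k, x) m) m x n := by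
  induction n with
  | zero => rfl
  | succ n ih => rw [← add_assoc, traj_succ, ih]; rfl

lemma traj_eq (σ : Γ.Strategy) (k : Γ.K) (x : ℝ) (n : ℕ) :
    Γ.traj σ (k, x) n = Γ.gtraj σ (k, []) 0 x n := by
  have := Γ.traj_add σ k x 0 n
  rwa [zero_add] at this

lemma gtraj_meas (σ : Γ.Strategy) (p0 : Γ.K × Γ.Hist) (m n : ℕ) (J : Set ℕ)
    (hJ : ∀ j < n, m + j ∈ J) (T : Set (Γ.K × Γ.Hist)) :
    MeasurableSet[sigJ J] {x | Γ.gtraj σ p0 m x n ∈ T} := by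
  induction n generalizing T with
  | zero => exact @MeasurableSet.const ℝ (sigJ J) (p0 ∈ T)
  | succ n ih =>
    have e : {x | Γ.gtraj σ p0 m x (n + 1) ∈ T} =
        ⋃ p : Γ.K × Γ.Hist, ({x | Γ.gtraj σ p0 m x n ∈ ({p} : Set (Γ.K × Γ.Hist))} ∩
          {x | Γ.stp σ p (unif x (m + n)) ∈ T}) := by
      ext x
      simp [gtraj]
    rw [e]
    refine MeasurableSet.iUnion fun p => MeasurableSet.inter (ih (fun j hj => hJ j (by omega)) _) ?_
    exact unif_measurable (hJ n (by omega)) (sampleOn_meas (Γ.q p.1 (σ p.2))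
      {y | ((y.1, p.2 ++ [(σ p.2, y.2)]) : Γ.K × Γ.Hist) ∈ T})

lemma traj_meas (σ : Γ.Strategy) (k : Γ.K) (n : ℕ) (T : Set (Γ.K × Γ.Hist)) :
    MeasurableSet[sigJ {j | j < n}] {x | Γ.traj σ (k, x) n ∈ T} := by
  simp only [traj_eq]
  exact Γ.gtraj_meas σ (k, []) 0 n _ (fun j hj => by simpa using hj) T

/-- the pair `(h, k')` has positive probability starting from `k` -/
def reach (σ : Γ.Strategy) (k : Γ.K) (h : Γ.Hist) (k' : Γ.K) : Prop :=
  0 < seedP {x | Γ.traj σ (k, x) h.length = (k', h)}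

lemma reach_nil (σ : Γ.Strategy) (k : Γ.K) : Γ.reach σ k [] k := by
  have : {x : ℝ | Γ.traj σ (k, x) ([] : Γ.Hist).length = (k, [])} = Set.univ := by
    ext x; simp [traj]
  rw [reach, this]; simp

lemma condStateProb_pos (σ : Γ.Strategy) (k : Γ.K) (h : Γ.Hist) (k' : Γ.K) :
    0 < Γ.condStateProb k σ h k' ↔ Γ.reach σ k h k' := by
  have e : {x : ℝ | (k, x) ∈ {ω : Γ.Env | Γ.hist σ ω h.length = h ∧ Γ.state σ ω h.length = k'}} =
      {x | Γ.traj σ (k, x) h.length = (k', h)} := by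
    ext x
    simp only [Set.mem_ofPred_eq, hist, state, Prod.ext_iff]
    tauto
  unfold condStateProb prob
  rw [envMeasure_dirac, envMeasure_dirac, e, reach]
  constructor
  · intro hpos
    by_contra hn
    have h0 : seedP {x | Γ.traj σ (k, x) h.length = (k', h)} = 0 := by
      simpa using hn
    rw [h0] at hpos; simp at hpos
  · intro hpos
    refine div_pos (ENNReal.toReal_pos hpos.ne' (measure_ne_top _ _))
      (ENNReal.toReal_pos ?_ (measure_ne_top _ _))
    refine (hpos.trans_le (measure_mono fun x hx => ?_)).ne'
    have hx' : Γ.traj σ (k, x) h.length = (k', h) := hx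
    change (Γ.traj σ (k, x) h.length).2 = h
    rw [hx']

lemma mem_superSuppH (σ : Γ.Strategy) {r : ℕ} (Kc : Fin r → Finset Γ.K)
    (h : Γ.Hist) (i : Fin r) (k' : Γ.K) :
    k' ∈ Γ.superSuppH σ Kc h i ↔ ∃ k ∈ Kc i, Γ.reach σ k h k' := by
  simp only [superSuppH, Set.mem_ofPred_eq, condStateProb_pos]

lemma histProb_pos (p : Γ.K → ℝ) (hp : IsBelief p) (σ : Γ.Strategy) (k : Γ.K) (hk : 0 < p k)
    (h : Γ.Hist) (k' : Γ.K) (hr : Γ.reach σ k h k') : 0 < Γ.histProb p σ h := by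
  have := Γ.envMeasure_prob p hp
  refine ENNReal.toReal_pos ?_ (measure_ne_top _ _)
  rw [envMeasure_apply]
  intro h0
  rw [Finset.sum_eq_zero_iff] at h0
  have h1 := h0 k (Finset.mem_univ _)
  rw [mul_eq_zero] at h1
  rcases h1 with h1 | h1
  · rw [ENNReal.ofReal_eq_zero] at h1; linarith
  · have hle : seedP {x | Γ.traj σ (k, x) h.length = (k', h)} ≤ 0 := by
      rw [← h1]
      refine measure_mono fun x hx => ?_
      have hx' : Γ.traj σ (k, x) h.length = (k', h) := hx
      change (Γ.traj σ (k, x) h.length).2 = h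
      rw [hx']
    exact absurd hr (not_lt.mpr hle)

lemma reach_step (σ : Γ.Strategy) (k : Γ.K) (h : Γ.Hist) (k' : Γ.K) (hr : Γ.reach σ k h k')
    (y : Γ.K × Γ.S) (hq : 0 < Γ.q k' (σ h) y) : Γ.reach σ k (h ++ [(σ h, y.2)]) y.1 := by
  have hi := sigJ_indep (J := {j | j < h.length}) (J' := {j | h.length ≤ j}) (by
    rw [Set.disjoint_left]; intro j hj hj'; exact absurd (show j < h.length from hj) (not_lt.mpr hj'))
  rw [ProbabilityTheory.Indep_iff] at hi
  have hm := hi {x | Γ.traj σ (k, x) h.length ∈ ({(k', h)} : Set (Γ.K × Γ.Hist))}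
    {x | sampleOn (Γ.q k' (σ h)) (unif x h.length) ∈ ({y} : Set (Γ.K × Γ.S))}
    (Γ.traj_meas σ k _ _)
    (unif_measurable (m := h.length) (le_refl h.length) (sampleOn_meas _ _))
  have hp := sampleOn_prob (Γ.q k' (σ h)) (Γ.q_nonneg _ _) (Γ.q_sum _ _) y hq h.length
  unfold reach
  refine lt_of_lt_of_le ?_ (measure_mono (μ := seedP) (s := {x | Γ.traj σ (k, x) h.length ∈ ({(k', h)} : Set (Γ.K × Γ.Hist))} ∩
    {x | sampleOn (Γ.q k' (σ h)) (unif x h.length) ∈ ({y} : Set (Γ.K × Γ.S))}) ?_)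
  · rw [hm]
    exact ENNReal.mul_pos hr.ne' hp.ne'
  · rintro x ⟨h1, h2⟩
    have h1' : Γ.traj σ (k, x) h.length = (k', h) := h1
    have h2' : sampleOn (Γ.q k' (σ h)) (unif x h.length) = y := h2
    change Γ.traj σ (k, x) (h ++ [(σ h, y.2)]).length = _
    rw [List.length_append, List.length_singleton, traj_succ, h1']
    simp only [stp, h2']

lemma tendsto_meas {α : Type*} [MeasurableSpace α] (f : ℕ → α → ℝ) (hf : ∀ n, Measurable (f n))
    (m : ℕ) (L : ℝ) : MeasurableSet {x | Tendsto
      (fun n : ℕ => (1 / ((m + n : ℕ) : ℝ)) * ∑ j ∈ Finset.range n, f j x) atTop (nhds L)} := by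
  refine measurableSet_tendsto (f := fun (n : ℕ) x =>
    (1 / ((m + n : ℕ) : ℝ)) * ∑ j ∈ Finset.range n, f j x) _ fun n => ?_
  exact (Finset.measurable_fun_sum _ fun j _ => hf j).const_mul _

/-- rewards after a restart -/
noncomputable def grew (σ : Γ.Strategy) (p0 : Γ.K × Γ.Hist) (m : ℕ) (j : ℕ) (x : ℝ) : ℝ :=
  Γ.g (Γ.gtraj σ p0 m x j).1 (σ (Γ.gtraj σ p0 m x j).2)

/-- the event that the average of rewards after a restart tends to `L` -/
def futEv (σ : Γ.Strategy) (p0 : Γ.K × Γ.Hist) (m : ℕ) (L : ℝ) : Set ℝ :=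
  {x | Tendsto (fun n : ℕ => (1 / ((m + n : ℕ) : ℝ)) *
    ∑ j ∈ Finset.range n, Γ.grew σ p0 m j x) atTop (nhds L)}

lemma futEv_meas (σ : Γ.Strategy) (p0 : Γ.K × Γ.Hist) (m : ℕ) (L : ℝ) :
    MeasurableSet[sigJ {j | m ≤ j}] (Γ.futEv σ p0 m L) := by
  refine @tendsto_meas ℝ (sigJ {j | m ≤ j}) (fun j x => Γ.grew σ p0 m j x) (fun n T _ => ?_) m L
  exact Γ.gtraj_meas σ p0 m n {j | m ≤ j} (fun j _ => Nat.le_add_right m j)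
    {p | Γ.g p.1 (σ p.2) ∈ T}

lemma avg_fut (σ : Γ.Strategy) (k : Γ.K) (x : ℝ) (m : ℕ) (L : ℝ)
    (h : Tendsto (Γ.avg σ (k, x)) atTop (nhds L)) :
    x ∈ Γ.futEv σ (Γ.traj σ (k, x) m) m L := by
  have h1 : Tendsto (fun n : ℕ => Γ.avg σ (k, x) (m + n)) atTop (nhds L) := by
    have := (tendsto_add_atTop_iff_nat m).mpr h
    simpa [add_comm] using this
  have h2 : Tendsto (fun n : ℕ => (1 / ((m + n : ℕ) : ℝ)) *
      ∑ j ∈ Finset.range m, Γ.rew σ (k, x) j) atTop (nhds 0) := by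
    have h3 : Tendsto (fun n : ℕ => (1 / ((n + m : ℕ) : ℝ))) atTop (nhds 0) :=
      (tendsto_add_atTop_iff_nat (f := fun n : ℕ => (1 / (n : ℝ))) m).mpr
        tendsto_one_div_atTop_nhds_zero_nat
    have h4 := h3.mul_const (∑ j ∈ Finset.range m, Γ.rew σ (k, x) j)
    rw [zero_mul] at h4
    simpa [add_comm] using h4
  have h5 := h1.sub h2
  rw [sub_zero] at h5
  refine h5.congr fun n => ?_
  unfold avg
  rw [Finset.sum_range_add, ← mul_sub, add_sub_cancel_left]
  congr 1
  refine Finset.sum_congr rfl fun j _ => ?_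
  simp only [rew, grew, state, act, hist, traj_add]

lemma fut_one (σ : Γ.Strategy) (k : Γ.K) (h : Γ.Hist) (k' : Γ.K) (hr : Γ.reach σ k h k') (L : ℝ)
    (hL : ∀ᵐ x ∂seedP, Tendsto (Γ.avg σ (k, x)) atTop (nhds L)) :
    ∀ᵐ x ∂seedP, x ∈ Γ.futEv σ (k', h) h.length L := by
  have hi := sigJ_indep (J := {j | j < h.length}) (J' := {j | h.length ≤ j}) (by
    rw [Set.disjoint_left]; intro j hj hj'; exact absurd (show j < h.length from hj) (not_lt.mpr hj'))
  rw [ProbabilityTheory.Indep_iff] at hi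
  have hm := hi {x | Γ.traj σ (k, x) h.length ∈ ({(k', h)} : Set (Γ.K × Γ.Hist))}
    (Γ.futEv σ (k', h) h.length L)ᶜ
    (Γ.traj_meas σ k _ _) (Γ.futEv_meas σ _ _ _).compl
  have h0 : seedP ({x | Γ.traj σ (k, x) h.length ∈ ({(k', h)} : Set (Γ.K × Γ.Hist))} ∩
      (Γ.futEv σ (k', h) h.length L)ᶜ) = 0 := by
    rw [ae_iff] at hL
    refine measure_mono_null ?_ hL
    rintro x ⟨h1, h2⟩ hx
    have h1' : Γ.traj σ (k, x) h.length = (k', h) := h1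
    have := Γ.avg_fut σ k x h.length L hx
    rw [h1'] at this
    exact h2 this
  rw [h0] at hm
  rcases mul_eq_zero.mp hm.symm with h1 | h1
  · exact absurd h1 hr.ne'
  · exact h1

lemma reach_unique (σ : Γ.Strategy) (k₁ k₂ : Γ.K) (h : Γ.Hist) (k' : Γ.K)
    (hr₁ : Γ.reach σ k₁ h k') (hr₂ : Γ.reach σ k₂ h k') (L₁ L₂ : ℝ)
    (hL₁ : ∀ᵐ x ∂seedP, Tendsto (Γ.avg σ (k₁, x)) atTop (nhds L₁))
    (hL₂ : ∀ᵐ x ∂seedP, Tendsto (Γ.avg σ (k₂, x)) atTop (nhds L₂)) : L₁ = L₂ := by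
  obtain ⟨x, hx₁, hx₂⟩ := ((Γ.fut_one σ k₁ h k' hr₁ L₁ hL₁).and
    (Γ.fut_one σ k₂ h k' hr₂ L₂ hL₂)).exists
  exact tendsto_nhds_unique hx₁ hx₂

lemma hist_succ (σ : Γ.Strategy) (ω : Γ.Env) (m : ℕ) :
    Γ.hist σ ω (m + 1) = Γ.hist σ ω m ++ [(σ (Γ.hist σ ω m),
      (sampleOn (Γ.q (Γ.state σ ω m) (σ (Γ.hist σ ω m))) (unif ω.2 m)).2)] := rfl

lemma state_succ (σ : Γ.Strategy) (ω : Γ.Env) (m : ℕ) :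
    Γ.state σ ω (m + 1) =
      (sampleOn (Γ.q (Γ.state σ ω m) (σ (Γ.hist σ ω m))) (unif ω.2 m)).1 := rfl

lemma hist_length (σ : Γ.Strategy) (ω : Γ.Env) (m : ℕ) : (Γ.hist σ ω m).length = m := by
  induction m with
  | zero => rfl
  | succ m ih => rw [hist_succ, List.length_append, ih]; rfl

end POMDP

lemma repHist_spec (Γ : POMDP) (pstar : Γ.K → ℝ) (σ : Γ.Strategy) {r : ℕ}
    (Kc : Fin r → Finset Γ.K) (h : Γ.Hist) (hp : 0 < Γ.histProb pstar σ h) :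
    Γ.superSuppH σ Kc (repHistOfVal Γ pstar σ Kc (Γ.superSuppH σ Kc h)) =
      Γ.superSuppH σ Kc h := by
  have hx : ∃ h' : Γ.Hist, 0 < Γ.histProb pstar σ h' ∧
      Γ.superSuppH σ Kc h' = Γ.superSuppH σ Kc h := ⟨h, hp, rfl⟩
  unfold repHistOfVal
  rw [dif_pos hx]
  exact hx.choose_spec.2

lemma blockRep_append (Γ : POMDP) (pstar : Γ.K → ℝ) (σ : Γ.Strategy) {r : ℕ}
    (Kc : Fin r → Finset Γ.K) (n0 s : ℕ) (h h' : Γ.Hist) (hl : s * n0 ≤ h.length) :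
    blockRep Γ pstar σ Kc n0 s (h ++ h') = blockRep Γ pstar σ Kc n0 s h := by
  induction s with
  | zero => rfl
  | succ s ih =>
    rw [Nat.succ_mul] at hl
    simp only [blockRep]
    rw [ih (by omega), List.drop_append_of_le_length (by omega),
      List.take_append_of_le_length (by rw [List.length_drop]; omega)]

lemma block_step (Γ : POMDP) (pstar : Γ.K → ℝ) (σ : Γ.Strategy)
    {r : ℕ} (Kc : Fin r → Finset Γ.K) (n0 : ℕ) 
    (ω : Γ.Env) (hω : ∀ m, unif ω.2 m < 1) (s : ℕ) (k : Γ.K) (hn0 : 1 ≤ n0)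
    (hr : Γ.reach σ k (blockRep Γ pstar σ Kc n0 s
        (Γ.hist (pomdpSigma' Γ pstar σ Kc n0) ω (s * n0)))
      (Γ.state (pomdpSigma' Γ pstar σ Kc n0) ω (s * n0))) (j : ℕ) (hj : j ≤ n0) :
    blockRep Γ pstar σ Kc n0 s (Γ.hist (pomdpSigma' Γ pstar σ Kc n0) ω (s * n0 + j)) =
      blockRep Γ pstar σ Kc n0 s (Γ.hist (pomdpSigma' Γ pstar σ Kc n0) ω (s * n0)) ∧
    Γ.reach σ k (blockRep Γ pstar σ Kc n0 s
        (Γ.hist (pomdpSigma' Γ pstar σ Kc n0) ω (s * n0)) ++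
        (Γ.hist (pomdpSigma' Γ pstar σ Kc n0) ω (s * n0 + j)).drop (s * n0))
      (Γ.state (pomdpSigma' Γ pstar σ Kc n0) ω (s * n0 + j)) := by
  set σ' := pomdpSigma' Γ pstar σ Kc n0 with hσ'
  induction j with
  | zero =>
    refine ⟨rfl, ?_⟩
    rw [add_zero, List.drop_of_length_le (by rw [Γ.hist_length]), List.append_nil]
    exact hr
  | succ j ih =>
    obtain ⟨ih1, ih2⟩ := ih (by omega)
    have hlen := Γ.hist_length σ' ω (s * n0 + j)
    have hdiv : (s * n0 + j) / n0 = s := by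
      rw [mul_comm, Nat.mul_add_div (by omega), Nat.div_eq_of_lt (by omega), add_zero]
    have hact : σ' (Γ.hist σ' ω (s * n0 + j)) =
        σ (blockRep Γ pstar σ Kc n0 s (Γ.hist σ' ω (s * n0)) ++
          (Γ.hist σ' ω (s * n0 + j)).drop (s * n0)) := by
      have hdef : ∀ h : Γ.Hist, σ' h = σ (blockRep Γ pstar σ Kc n0 (h.length / n0) h ++
          h.drop (h.length / n0 * n0)) := fun h => rfl
      rw [hdef, hlen, hdiv, ih1]
    rw [← add_assoc, Γ.hist_succ, Γ.state_succ]
    refine ⟨by rw [blockRep_append _ _ _ _ _ _ _ _ (by rw [hlen]; omega), ih1], ?_⟩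
    rw [List.drop_append_of_le_length (by rw [hlen]; omega), ← List.append_assoc, hact]
    refine Γ.reach_step σ k _ _ ih2 _ ?_
    exact sampleOn_pos _ (Γ.q_nonneg _ _) (Γ.q_sum _ _) _ (unif_nonneg _ _) (hω _)

lemma block_inv (Γ : POMDP) (pstar : Γ.K → ℝ) (hps : IsBelief pstar) (σ : Γ.Strategy)
    {r : ℕ} (Kc : Fin r → Finset Γ.K) (hKc : ∀ i, ∀ k ∈ Kc i, 0 < pstar k)
    (n0 : ℕ) (hn0 : 1 ≤ n0) (i : Fin r)
    (ω : Γ.Env) (hω : ∀ m, unif ω.2 m < 1) (hk : ω.1 ∈ Kc i) (s : ℕ) :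
    Γ.state (pomdpSigma' Γ pstar σ Kc n0) ω (s * n0) ∈ Γ.superSuppH σ Kc
      (blockRep Γ pstar σ Kc n0 s (Γ.hist (pomdpSigma' Γ pstar σ Kc n0) ω (s * n0))) i := by
  induction s with
  | zero =>
    have hr := Γ.reach_nil σ ω.1
    simp only [zero_mul, blockRep]
    rw [repHist_spec _ _ _ _ _ (Γ.histProb_pos pstar hps σ ω.1 (hKc i _ hk) [] _ hr),
      Γ.mem_superSuppH]
    exact ⟨ω.1, hk, hr⟩
  | succ s ih =>
    rw [Γ.mem_superSuppH] at ih
    obtain ⟨k, hki, hr⟩ := ih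
    obtain ⟨h1, h2⟩ := block_step Γ pstar σ Kc n0 ω hω s k hn0 hr n0 le_rfl
    rw [Nat.succ_mul]
    simp only [blockRep]
    rw [h1, List.take_of_length_le (by rw [List.length_drop, Γ.hist_length]; omega),
      repHist_spec _ _ _ _ _ (Γ.histProb_pos pstar hps σ k (hKc i _ hki) _ _ h2),
      Γ.mem_superSuppH]
    exact ⟨k, hki, h2⟩

/-- **Lemma 7.** Under the strategy `σ'`, almost surely the state at stage `s·n0 + 1` lies
in `B^i_{j_s}` if and only if the initial state lies in `K_i`; consequently `B_{j_s}` is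
a partition of the support of the law of the state at stage `s·n0 + 1`, and
`P^{p*}_{σ'}(k_{s·n0+1} ∈ B^i_{j_s}) = p*(K_i)`. -/
theorem pomdp_superSupp_invariant (Γ : POMDP)
    (pstar : Γ.K → ℝ) (hps : IsBelief pstar) (σ : Γ.Strategy)
    (herg : ∀ k, 0 < pstar k →
      ∀ᵐ ω ∂(Γ.envMeasure (diracBelief k)),
        Tendsto (Γ.avg σ ω) atTop (nhds (Γ.payK k σ)))
    (r : ℕ) (Kc : Fin r → Finset Γ.K) (γv : Fin r → ℝ)
    (hKc : ∀ k, 0 < pstar k ↔ ∃ i, k ∈ Kc i)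
    (hcl : ∀ i, ∀ k ∈ Kc i, Γ.payK k σ = γv i)
    (hdist : ∀ i j, i ≠ j → γv i ≠ γv j)
    (hne : ∀ i, (Kc i).Nonempty)
    (n0 : ℕ) (hn0 : 1 ≤ n0) (i : Fin r) (s : ℕ) :
    (Γ.prob pstar (pomdpSigma' Γ pstar σ Kc n0)
        {ω | Γ.state (pomdpSigma' Γ pstar σ Kc n0) ω (s * n0)
              ∈ Γ.superSuppH σ Kc
                  (blockRep Γ pstar σ Kc n0 s
                    (Γ.hist (pomdpSigma' Γ pstar σ Kc n0) ω (s * n0))) i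
            ↔ Γ.state (pomdpSigma' Γ pstar σ Kc n0) ω 0 ∈ Kc i} = 1) ∧
    (∀ h : Γ.Hist, h.length = s * n0 →
      0 < Γ.histProb pstar (pomdpSigma' Γ pstar σ Kc n0) h →
      ∀ j, i ≠ j →
        Disjoint (Γ.superSuppH σ Kc (blockRep Γ pstar σ Kc n0 s h) i)
          (Γ.superSuppH σ Kc (blockRep Γ pstar σ Kc n0 s h) j)) ∧
    (Γ.prob pstar (pomdpSigma' Γ pstar σ Kc n0)
        {ω | Γ.state (pomdpSigma' Γ pstar σ Kc n0) ω (s * n0)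
              ∈ ⋃ j, Γ.superSuppH σ Kc
                  (blockRep Γ pstar σ Kc n0 s
                    (Γ.hist (pomdpSigma' Γ pstar σ Kc n0) ω (s * n0))) j} = 1) ∧
    (Γ.prob pstar (pomdpSigma' Γ pstar σ Kc n0)
        {ω | Γ.state (pomdpSigma' Γ pstar σ Kc n0) ω (s * n0)
              ∈ Γ.superSuppH σ Kc
                  (blockRep Γ pstar σ Kc n0 s
                    (Γ.hist (pomdpSigma' Γ pstar σ Kc n0) ω (s * n0))) i}
      = ∑ k ∈ Kc i, pstar k) := by
  have hpos : ∀ i, ∀ k ∈ Kc i, 0 < pstar k := fun i k hk => (hKc k).2 ⟨i, hk⟩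
  have herg' : ∀ i, ∀ k ∈ Kc i,
      ∀ᵐ x ∂seedP, Tendsto (Γ.avg σ (k, x)) atTop (nhds (γv i)) := by
    intro i k hk
    have h := herg k (hpos i k hk)
    rw [hcl i k hk, ae_iff, Γ.envMeasure_dirac] at h
    exact h
  have hdisj : ∀ (h : Γ.Hist) (i j : Fin r), i ≠ j →
      Disjoint (Γ.superSuppH σ Kc h i) (Γ.superSuppH σ Kc h j) := by
    intro h i j hij
    rw [Set.disjoint_left]
    intro k' hi hj
    rw [Γ.mem_superSuppH] at hi hj
    obtain ⟨k₁, hk₁, hr₁⟩ := hi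
    obtain ⟨k₂, hk₂, hr₂⟩ := hj
    exact hdist i j hij
      (Γ.reach_unique σ k₁ k₂ h k' hr₁ hr₂ _ _ (herg' i k₁ hk₁) (herg' j k₂ hk₂))
  have := Γ.envMeasure_prob pstar hps
  have hgood : ∀ᵐ ω ∂(Γ.envMeasure pstar), (∀ m, unif ω.2 m < 1) ∧ 0 < pstar ω.1 := by
    refine Γ.ae_env pstar (fun ω => (∀ m, unif ω.2 m < 1) ∧ 0 < pstar ω.1) fun k hk => ?_
    filter_upwards [ae_all_iff.mpr unif_ae_lt_one] with x hx
    exact ⟨hx, hk⟩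
  set σ' := pomdpSigma' Γ pstar σ Kc n0 with hσ'
  have hiff : ∀ᵐ ω ∂(Γ.envMeasure pstar), (Γ.state σ' ω (s * n0) ∈ Γ.superSuppH σ Kc
      (blockRep Γ pstar σ Kc n0 s (Γ.hist σ' ω (s * n0))) i ↔ ω.1 ∈ Kc i) := by
    filter_upwards [hgood] with ω hω
    refine ⟨fun hmem => ?_, fun hk => block_inv Γ pstar hps σ Kc hpos n0 hn0 i ω hω.1 hk s⟩
    obtain ⟨j, hj⟩ := (hKc ω.1).1 hω.2
    by_cases hij : i = j
    · rw [hij]; exact hj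
    · exact absurd (block_inv Γ pstar hps σ Kc hpos n0 hn0 j ω hω.1 hj s)
        (Set.disjoint_left.mp (hdisj _ i j hij) hmem)
  have hone : ∀ E : Set Γ.Env, (∀ᵐ ω ∂(Γ.envMeasure pstar), ω ∈ E) → Γ.prob pstar σ' E = 1 := by
    intro E hE
    have : Γ.envMeasure pstar E = 1 := by
      have h2 : E =ᵐ[Γ.envMeasure pstar] Set.univ := eventuallyEq_univ.mpr hE
      rw [measure_congr h2, measure_univ]
    rw [POMDP.prob, this, ENNReal.toReal_one]
  refine ⟨hone _ hiff, fun h _ _ j hij => hdisj _ i j hij, hone _ ?_, ?_⟩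
  · filter_upwards [hgood] with ω hω
    obtain ⟨j, hj⟩ := (hKc ω.1).1 hω.2
    exact Set.mem_iUnion.mpr ⟨j, block_inv Γ pstar hps σ Kc hpos n0 hn0 j ω hω.1 hj s⟩
  · have e : Γ.envMeasure pstar {ω | Γ.state σ' ω (s * n0) ∈ Γ.superSuppH σ Kc
        (blockRep Γ pstar σ Kc n0 s (Γ.hist σ' ω (s * n0))) i} =
        Γ.envMeasure pstar {ω | ω.1 ∈ Kc i} := by
      refine measure_congr ?_
      filter_upwards [hiff] with ω hω
      exact propext hω
    rw [POMDP.prob, e, Γ.envMeasure_apply]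
    have e2 : ∀ k, ENNReal.ofReal (pstar k) * seedP {x | (k, x) ∈ {ω : Γ.Env | ω.1 ∈ Kc i}} =
        if k ∈ Kc i then ENNReal.ofReal (pstar k) else 0 := by
      intro k
      by_cases hk : k ∈ Kc i
      · have : {x : ℝ | (k, x) ∈ {ω : Γ.Env | ω.1 ∈ Kc i}} = Set.univ := by
          ext x; simp [hk]
        rw [this, measure_univ, mul_one, if_pos hk]
      · have : {x : ℝ | (k, x) ∈ {ω : Γ.Env | ω.1 ∈ Kc i}} = ∅ := by
          ext x; simp [hk]
        rw [this, measure_empty, mul_zero, if_neg hk]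
    rw [Finset.sum_congr rfl fun k _ => e2 k, Finset.sum_ite_mem, Finset.univ_inter,
      ← ENNReal.ofReal_sum_of_nonneg fun k _ => hps.1 k,
      ENNReal.toReal_ofReal (Finset.sum_nonneg fun k _ => hps.1 k)]

end PomdpPaper
end

section
/- Let Γ be a POMDP, p* ∈ Δ(K), and σ a strategy such that for every k ∈ Supp(p*), (1/n) Σ_{m=1}^n g_m → γ^k_∞(σ) P^k_σ-almost surely. Then for every ε > 0 there exists a finite-memory strategy σ' with γ^{p*}_∞(σ') ≥ γ^{p*}_∞(σ) − ε. -/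
open MeasureTheory Filter

namespace PomdpPaper

section Unif

noncomputable abbrev muU : Measure ℝ := volume.restrict (Set.Ico (0 : ℝ) 1)

instance : IsProbabilityMeasure muU := ⟨by simp [muU]⟩

noncomputable def digB (x : ℝ) (i : ℕ) : Bool := decide (⌊x * 2 ^ (i + 1)⌋ % 2 = 1)

def codeB (b : ℕ → Bool) : ℕ → ℤ
  | 0 => 0
  | n + 1 => 2 * codeB b n + if b n then 1 else 0

lemma floor_step (x : ℝ) (n : ℕ) : ⌊x * 2 ^ (n + 1)⌋ / 2 = ⌊x * 2 ^ n⌋ := by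
  have h : x * 2 ^ n = (x * 2 ^ (n + 1)) / ((2 : ℕ) : ℝ) := by
    rw [pow_succ]; push_cast; ring
  rw [h, Int.floor_div_natCast]
  norm_num

lemma prefix_iff (b : ℕ → Bool) (n : ℕ) (x : ℝ) :
    (x ∈ Set.Ico (0 : ℝ) 1 ∧ ∀ i < n, digB x i = b i) ↔ ⌊x * 2 ^ n⌋ = codeB b n := by
  induction n with
  | zero => simp [codeB, Int.floor_eq_iff]
  | succ n ih =>
    have h1 := floor_step x n
    have : (x ∈ Set.Ico (0 : ℝ) 1 ∧ ∀ i < n + 1, digB x i = b i) ↔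
        (x ∈ Set.Ico (0 : ℝ) 1 ∧ ∀ i < n, digB x i = b i) ∧ digB x n = b n := by
      rw [Nat.forall_lt_succ_right]; tauto
    rw [this, ih, codeB, ← h1]
    unfold digB
    cases hb : b n <;> simp <;> omega

lemma measurable_digB (i : ℕ) : Measurable (fun x => digB x i) := by
  unfold digB
  have h : Measurable (fun x : ℝ => ⌊x * 2 ^ (i + 1)⌋) :=
    Int.measurable_floor.comp (measurable_id.mul_const _)
  exact (measurable_from_top (f := fun z : ℤ => decide (z % 2 = 1))).comp h

noncomputable def DB (x : ℝ) : ℕ → Bool := fun i => digB x i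

lemma measurable_DB : Measurable DB := measurable_pi_iff.2 measurable_digB

lemma prefix_measure (b : ℕ → Bool) (n : ℕ) :
    muU {x | ∀ i < n, digB x i = b i} = (2⁻¹ : ENNReal) ^ n := by
  have hm : MeasurableSet {x | ∀ i < n, digB x i = b i} := by
    have : {x | ∀ i < n, digB x i = b i} = ⋂ i, ⋂ (_ : i < n), (fun x => digB x i) ⁻¹' {b i} := by
      ext; simp
    rw [this]
    exact MeasurableSet.iInter fun i => MeasurableSet.iInter fun _ =>
      measurable_digB i (MeasurableSet.singleton _)
  rw [Measure.restrict_apply hm]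
  have h2 : {x | ∀ i < n, digB x i = b i} ∩ Set.Ico (0 : ℝ) 1 =
      Set.Ico ((codeB b n : ℝ) / 2 ^ n) ((codeB b n + 1 : ℝ) / 2 ^ n) := by
    ext x
    have := prefix_iff b n x
    have hp : (0 : ℝ) < 2 ^ n := by positivity
    rw [Set.mem_inter_iff, and_comm, Set.mem_ofPred_eq, this, Int.floor_eq_iff, Set.mem_Ico,
      div_le_iff₀ hp, lt_div_iff₀ hp]
  rw [h2, Real.volume_Ico, ← sub_div, add_sub_cancel_left, one_div, ← inv_pow,
    ENNReal.ofReal_pow (by norm_num), ENNReal.ofReal_inv_of_pos (by norm_num)]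
  norm_num

noncomputable def coin : Measure Bool := (2⁻¹ : ENNReal) • Measure.count

lemma coin_singleton (b : Bool) : coin {b} = 2⁻¹ := by
  simp [coin]

instance : IsProbabilityMeasure coin := ⟨by
  have h : (Set.univ : Set Bool) = {false} ∪ {true} := by ext b; cases b <;> simp
  rw [h, measure_union (by simp) (MeasurableSet.singleton _), coin_singleton, coin_singleton,
    ENNReal.inv_two_add_inv_two]⟩

lemma map_DB : muU.map DB = Measure.infinitePi (fun _ : ℕ => coin) := by
  have key : ∀ n : ℕ, (muU.map DB).map (Finset.range n).restrict =
      (Measure.infinitePi (fun _ : ℕ => coin)).map (Finset.range n).restrict := by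
    intro n
    have hr : Measurable ((Finset.range n).restrict : (ℕ → Bool) → _) := Finset.measurable_restrict _
    have : ∀ c : (Finset.range n) → Bool, ((muU.map DB).map (Finset.range n).restrict) {c} =
      ((Measure.infinitePi (fun _ : ℕ => coin)).map (Finset.range n).restrict) {c} := by
      intro c
      let b : ℕ → Bool := fun i => if h : i ∈ Finset.range n then c ⟨i, h⟩ else true
      have h0 : ((Finset.range n).restrict : (ℕ → Bool) → _) ⁻¹' {c} =
          Set.pi (Finset.range n) (fun i => {b i}) := by
        ext f
        simp only [Set.mem_preimage, Set.mem_singleton_iff, Set.mem_pi, funext_iff]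
        constructor
        · intro h i hi
          have := h ⟨i, hi⟩
          have hi' : i ∈ Finset.range n := hi
          simp only [b, dif_pos hi']
          simpa using this
        · rintro h ⟨i, hi⟩
          have := h i hi
          simp only [b, dif_pos hi] at this
          simpa using this
      rw [Measure.map_apply hr (MeasurableSet.singleton _),
        Measure.map_apply hr (MeasurableSet.singleton _), h0,
        Measure.infinitePi_pi _ (fun i _ => MeasurableSet.singleton _),
        Measure.map_apply measurable_DB
          (MeasurableSet.pi (Finset.range n).countable_toSet fun i _ => MeasurableSet.singleton _)]
      simp only [coin_singleton, Finset.prod_const, Finset.card_range]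
      rw [← prefix_measure b n]
      congr 1
      ext x
      simp [DB]
    exact Measure.ext_of_singleton this
  refine Measure.eq_infinitePi _ ?_
  intro s t ht
  obtain ⟨n, hn⟩ : ∃ n, s ⊆ Finset.range n := s.exists_nat_subset_range
  rw [← Measure.infinitePi_pi (fun _ : ℕ => coin) (fun i _ => ht i)]
  have hr : Measurable ((Finset.range n).restrict : (ℕ → Bool) → _) := Finset.measurable_restrict _
  have h0 : Set.pi (s : Set ℕ) t = ((Finset.range n).restrict : (ℕ → Bool) → _) ⁻¹'
      {c | ∀ i (h : i ∈ s), c ⟨i, hn h⟩ ∈ t i} := by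
    ext f; simp
  rw [h0, ← Measure.map_apply hr (Set.toFinite _).measurableSet,
    ← Measure.map_apply hr (Set.toFinite _).measurableSet, key]

noncomputable def UB (b : ℕ → Bool) : ℝ := ∑' j : ℕ, (if b j then (1 : ℝ) else 0) / 2 ^ (j + 1)

lemma unif_eq (x : ℝ) (m : ℕ) : unif x m = UB (fun j => DB x (Nat.pair m j)) := by
  unfold unif UB digitR DB digB
  simp

lemma summable_UB (b : ℕ → Bool) :
    Summable (fun j : ℕ => (if b j then (1 : ℝ) else 0) / 2 ^ (j + 1)) := by
  have : Summable (fun j : ℕ => ((1 : ℝ) / 2) ^ (j + 1)) :=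
    (summable_nat_add_iff 1).2 summable_geometric_two
  refine Summable.of_nonneg_of_le (fun j => by positivity) (fun j => ?_) this
  rw [div_pow, one_pow]
  gcongr
  split_ifs <;> norm_num

lemma measurable_UB : Measurable UB := by
  have h : ∀ n, Measurable (fun b : ℕ → Bool =>
      ∑ j ∈ Finset.range n, (if b j then (1 : ℝ) else 0) / 2 ^ (j + 1)) := by
    intro n
    refine Finset.measurable_sum _ fun j _ => Measurable.div_const ?_ _
    exact (measurable_from_top (f := fun c : Bool => if c then (1 : ℝ) else 0)).comp
      (measurable_pi_apply j)
  refine measurable_of_tendsto_metrizable h (tendsto_pi_nhds.2 fun b => ?_)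
  exact (summable_UB b).hasSum.tendsto_sum_nat

lemma UB_DB (x : ℝ) (hx : x ∈ Set.Ico (0 : ℝ) 1) : UB (DB x) = x := by
  have h1 : ∀ n, ∑ j ∈ Finset.range n, (if DB x j then (1 : ℝ) else 0) / 2 ^ (j + 1) =
      (⌊x * 2 ^ n⌋ : ℝ) / 2 ^ n := by
    intro n
    have := (prefix_iff (DB x) n x).1 ⟨hx, fun i _ => rfl⟩
    rw [this]
    clear this
    induction n with
    | zero => simp [codeB]
    | succ n ih =>
      rw [Finset.sum_range_succ, ih, codeB]
      split_ifs <;> push_cast <;> field_simp <;> ring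
  have h2 := (summable_UB (DB x)).hasSum.tendsto_sum_nat
  simp_rw [h1] at h2
  refine tendsto_nhds_unique h2 ?_
  have h3 : Tendsto (fun n : ℕ => x - ((1 : ℝ) / 2) ^ n) atTop (nhds x) := by
    simpa using tendsto_const_nhds.sub
      (tendsto_pow_atTop_nhds_zero_of_lt_one (r := (1 : ℝ) / 2) (by norm_num) (by norm_num))
  refine tendsto_of_tendsto_of_tendsto_of_le_of_le h3 tendsto_const_nhds (fun n => ?_) (fun n => ?_)
  · have hp : (0 : ℝ) < 2 ^ n := by positivity
    have := Int.sub_one_lt_floor (x * 2 ^ n)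
    simp only [div_pow, one_pow]
    rw [le_div_iff₀ hp, sub_mul, div_mul_cancel₀ _ hp.ne']
    exact this.le
  · have hp : (0 : ℝ) < 2 ^ n := by positivity
    simp only
    rw [div_le_iff₀ hp]
    exact Int.floor_le _

lemma map_UB : (Measure.infinitePi (fun _ : ℕ => coin)).map UB = muU := by
  rw [← map_DB, Measure.map_map measurable_UB measurable_DB]
  have : UB ∘ DB =ᵐ[muU] id := by
    filter_upwards [ae_restrict_mem measurableSet_Ico] with x hx using UB_DB x hx
  rw [Measure.map_congr this, Measure.map_id]

lemma measurable_unif (m : ℕ) : Measurable (fun x => unif x m) := by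
  simp_rw [unif_eq]
  refine measurable_UB.comp (measurable_pi_iff.2 fun j => measurable_digB _)

lemma map_unif_all : muU.map (fun x m => unif x m) = Measure.infinitePi (fun _ : ℕ => muU) := by
  have e : (fun x m => unif x m) = (fun (c : ℕ → ℕ → Bool) m => UB (c m)) ∘
      (MeasurableEquiv.curry ℕ ℕ Bool) ∘ (fun (b : ℕ → Bool) (p : ℕ × ℕ) => b (Nat.pair p.1 p.2)) ∘ DB := by
    ext x m
    simp only [unif_eq]
    rfl
  have m1 : Measurable (fun (b : ℕ → Bool) (p : ℕ × ℕ) => b (Nat.pair p.1 p.2)) := by fun_prop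
  have m3 : Measurable (fun (c : ℕ → ℕ → Bool) m => UB (c m)) :=
    measurable_pi_iff.2 fun m => measurable_UB.comp (measurable_pi_apply m)
  have m4 := m1.comp measurable_DB
  have m5 := (MeasurableEquiv.curry ℕ ℕ Bool).measurable
  rw [e, ← Measure.map_map m3 (m5.comp m4), ← Measure.map_map m5 m4,
    ← Measure.map_map m1 measurable_DB, map_DB]
  have hinj : Function.Injective (fun p : ℕ × ℕ => Nat.pair p.1 p.2) := by
    intro a b h
    have := Nat.pair_eq_pair.1 h
    exact Prod.ext this.1 this.2
  have h1 : Measure.map (fun (b : ℕ → Bool) (p : ℕ × ℕ) => b (Nat.pair p.1 p.2))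
      (Measure.infinitePi fun _ : ℕ => coin) = Measure.infinitePi (fun _ : ℕ × ℕ => coin) :=
    Measure.map_infinitePi_infinitePi_of_inj hinj
  rw [h1, Measure.infinitePi_map_curry (fun _ _ => coin),
    Measure.infinitePi_map_pi (f := fun _ => UB) _ (fun _ => measurable_UB)]
  simp_rw [map_UB]

lemma map_unif (m : ℕ) : muU.map (fun x => unif x m) = muU := by
  have h := Measure.infinitePi_map_eval (fun _ : ℕ => muU) m
  rw [← map_unif_all, Measure.map_map (by fun_prop) (measurable_pi_iff.2 measurable_unif)] at h
  exact h

lemma iIndep_unif : ProbabilityTheory.iIndepFun (fun m x => unif x m) muU := by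
  rw [ProbabilityTheory.iIndepFun_iff_map_fun_eq_infinitePi_map measurable_unif, map_unif_all]
  simp_rw [map_unif]

end Unif
section Sampling

open Classical in
lemma sampleFin_iff {n : ℕ} (hn : 0 < n) (p : Fin n → ℝ) (u : ℝ) (y : Fin n) :
    sampleFin hn p u = y ↔
      ((u < ∑ z ∈ Finset.univ.filter (fun z : Fin n => z ≤ y), p z) ∧
        ∀ w < y, ∑ z ∈ Finset.univ.filter (fun z : Fin n => z ≤ w), p z ≤ u) ∨
      (y = ⟨0, hn⟩ ∧ ∀ w, ∑ z ∈ Finset.univ.filter (fun z : Fin n => z ≤ w), p z ≤ u) := by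
  unfold sampleFin
  simp only
  split_ifs with hs
  · have h1 := Finset.min'_mem _ hs
    constructor
    · rintro rfl
      left
      refine ⟨(Finset.mem_filter.1 h1).2, fun w hw => ?_⟩
      by_contra hc
      push Not at hc
      exact absurd (Finset.min'_le _ w (Finset.mem_filter.2 ⟨Finset.mem_univ _, hc⟩)) (not_le.2 hw)
    · rintro (⟨h3, h4⟩ | ⟨_, h4⟩)
      · apply le_antisymm
        · exact Finset.min'_le _ y (Finset.mem_filter.2 ⟨Finset.mem_univ _, h3⟩)
        · by_contra hc
          push Not at hc
          exact absurd (Finset.mem_filter.1 h1).2 (not_lt.2 (h4 _ hc))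
      · exact absurd (Finset.mem_filter.1 h1).2 (not_lt.2 (h4 _))
  · have h3 : ∀ w, ∑ z ∈ Finset.univ.filter (fun z : Fin n => z ≤ w), p z ≤ u := by
      intro w
      by_contra hc
      push Not at hc
      exact hs ⟨w, Finset.mem_filter.2 ⟨Finset.mem_univ _, hc⟩⟩
    constructor
    · rintro rfl
      exact Or.inr ⟨rfl, h3⟩
    · rintro (⟨h4, _⟩ | ⟨h4, _⟩)
      · exact absurd h4 (not_lt.2 (h3 y))
      · exact h4.symm

lemma measurableSet_sampleFin {n : ℕ} (hn : 0 < n) (p : Fin n → ℝ) (y : Fin n) :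
    MeasurableSet {u | sampleFin hn p u = y} := by
  have h1 : {u | sampleFin hn p u = y} =
      (Set.Iio (∑ z ∈ Finset.univ.filter (fun z : Fin n => z ≤ y), p z) ∩
        ⋂ w, ⋂ (_ : w < y), Set.Ici (∑ z ∈ Finset.univ.filter (fun z : Fin n => z ≤ w), p z)) ∪
      ({_u | y = ⟨0, hn⟩} ∩
        ⋂ w, Set.Ici (∑ z ∈ Finset.univ.filter (fun z : Fin n => z ≤ w), p z)) := by
    ext u
    simp only [Set.mem_ofPred_eq, sampleFin_iff, Set.mem_union, Set.mem_inter_iff, Set.mem_Iio,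
      Set.mem_iInter, Set.mem_Ici]
  rw [h1]
  refine (measurableSet_Iio.inter (MeasurableSet.iInter fun w => MeasurableSet.iInter fun _ =>
    measurableSet_Ici)).union ((MeasurableSet.const _).inter
      (MeasurableSet.iInter fun w => measurableSet_Ici))

lemma sampleFin_measure {n : ℕ} (hn : 0 < n) (p : Fin n → ℝ) (hp : ∀ z, 0 ≤ p z)
    (hs : ∑ z, p z = 1) (y : Fin n) :
    muU {u | sampleFin hn p u = y} = ENNReal.ofReal (p y) := by
  classical
  rw [Measure.restrict_apply (measurableSet_sampleFin hn p y)]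
  have hsub : Finset.univ.filter (fun z : Fin n => z ≤ y) =
      insert y (Finset.univ.filter (fun z : Fin n => z < y)) := by
    ext z; simp [le_iff_eq_or_lt]
  have hsum : ∑ z ∈ Finset.univ.filter (fun z : Fin n => z ≤ y), p z =
      p y + ∑ z ∈ Finset.univ.filter (fun z : Fin n => z < y), p z := by
    rw [hsub, Finset.sum_insert (by simp)]
  have hle : ∑ z ∈ Finset.univ.filter (fun z : Fin n => z ≤ y), p z ≤ 1 := by
    rw [← hs]
    exact Finset.sum_le_sum_of_subset_of_nonneg (Finset.filter_subset _ _) (fun i _ _ => hp i)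
  have hge : 0 ≤ ∑ z ∈ Finset.univ.filter (fun z : Fin n => z < y), p z :=
    Finset.sum_nonneg fun i _ => hp i
  have hset : {u | sampleFin hn p u = y} ∩ Set.Ico (0 : ℝ) 1 =
      Set.Ico (∑ z ∈ Finset.univ.filter (fun z : Fin n => z < y), p z)
        (∑ z ∈ Finset.univ.filter (fun z : Fin n => z ≤ y), p z) := by
    ext u
    simp only [Set.mem_inter_iff, Set.mem_ofPred_eq, Set.mem_Ico]
    rw [sampleFin_iff]
    constructor
    · rintro ⟨⟨h1, h2⟩ | ⟨_, h2⟩, h0, h3⟩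
      · refine ⟨?_, h1⟩
        by_cases hy : y.val = 0
        · have : Finset.univ.filter (fun z : Fin n => z < y) = ∅ := by
            ext z; simp [Fin.le_def, hy]
          rw [this]; simpa using h0
        · have hlt : (⟨y.val - 1, by omega⟩ : Fin n) < y := by
            rw [Fin.lt_def]; simp only; omega
          refine le_trans (le_of_eq ?_) (h2 _ hlt)
          congr 1
          ext z
          simp only [Finset.mem_filter, Finset.mem_univ, true_and, Fin.lt_def, Fin.le_def]
          omega
      · exfalso
        have := h2 ⟨n - 1, by omega⟩
        have he : Finset.univ.filter (fun z : Fin n => z ≤ ⟨n - 1, by omega⟩) = Finset.univ := by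
          ext z
          simp only [Finset.mem_filter, Finset.mem_univ, true_and, Fin.le_def, iff_true]
          omega
        rw [he, hs] at this
        linarith
    · rintro ⟨h1, h2⟩
      refine ⟨Or.inl ⟨h2, fun w hw => le_trans ?_ h1⟩, by linarith, by linarith⟩
      refine Finset.sum_le_sum_of_subset_of_nonneg ?_ (fun i _ _ => hp i)
      intro z hz
      simp only [Finset.mem_filter, Finset.mem_univ, true_and] at hz ⊢
      exact lt_of_le_of_lt hz hw
  rw [hset, Real.volume_Ico, hsum, add_sub_cancel_right]

lemma sampleOn_set {β : Type*} [Fintype β] [Nonempty β] (p : β → ℝ) (y : β) :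
    {u | sampleOn p u = y} = {u | sampleFin Fintype.card_pos
      (fun i => p ((Fintype.equivFin β).symm i)) u = Fintype.equivFin β y} := by
  ext u
  simp only [Set.mem_ofPred_eq, sampleOn]
  exact Equiv.symm_apply_eq _

lemma measurableSet_sampleOn {β : Type*} [Fintype β] [Nonempty β] (p : β → ℝ) (y : β) :
    MeasurableSet {u | sampleOn p u = y} := by
  rw [sampleOn_set]
  exact measurableSet_sampleFin _ _ _

lemma sampleOn_measure {β : Type*} [Fintype β] [Nonempty β] (p : β → ℝ) (hp : ∀ z, 0 ≤ p z)
    (hs : ∑ z, p z = 1) (y : β) :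
    muU {u | sampleOn p u = y} = ENNReal.ofReal (p y) := by
  rw [sampleOn_set, sampleFin_measure _ _ (fun z => hp _)]
  · simp
  · rw [← hs]
    exact Equiv.sum_comp (Fintype.equivFin β).symm p

lemma measurable_sampleOn {β : Type*} [Fintype β] [Nonempty β] (p : β → ℝ) :
    @Measurable _ _ _ ⊤ (sampleOn p) := by
  let : MeasurableSpace β := ⊤
  exact measurable_to_countable' fun y => measurableSet_sampleOn p y

end Sampling

section Step

@[reducible] noncomputable def FF (m : ℕ) : MeasurableSpace ℝ :=
  ⨆ i ∈ Set.Iio m, MeasurableSpace.comap (fun x => unif x i) inferInstance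

lemma FF_le (m : ℕ) : FF m ≤ (inferInstance : MeasurableSpace ℝ) :=
  iSup₂_le fun i _ => (measurable_unif i).comap_le

lemma FF_mono {m n : ℕ} (h : m ≤ n) : FF m ≤ FF n :=
  biSup_mono fun _ hi => lt_of_lt_of_le hi h

lemma FF_unif (m : ℕ) : Measurable[FF (m + 1)] (fun x => unif x m) := by
  have h : MeasurableSpace.comap (fun x => unif x m) inferInstance ≤ FF (m + 1) :=
    le_biSup (fun i => MeasurableSpace.comap (fun x => unif x i) inferInstance)
      (show m ∈ Set.Iio (m + 1) from Nat.lt_succ_self m)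
  exact Measurable.mono (comap_measurable _) h le_rfl

lemma FF_indep (m : ℕ) : ProbabilityTheory.Indep (FF m)
    (MeasurableSpace.comap (fun x => unif x m) inferInstance) muU := by
  have h := ProbabilityTheory.indep_iSup_of_disjoint (μ := muU)
    (m := fun i => MeasurableSpace.comap (fun x => unif x i) inferInstance)
    (fun i => (measurable_unif i).comap_le) iIndep_unif
    (S := Set.Iio m) (T := {m}) (by simp)
  simpa [FF] using h

lemma bdd_int {f : ℝ → ℝ} (hf : Measurable f) {C : ℝ} (hC : ∀ x, |f x| ≤ C) :
    Integrable f muU :=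
  Integrable.of_bound hf.aestronglyMeasurable C (ae_of_all _ hC)

variable (Γ : POMDP)

lemma traj_meas (σ : Γ.Strategy) (k : Γ.K) (m : ℕ) :
    @Measurable _ _ (FF m) ⊤ (fun x => Γ.traj σ (k, x) m) := by
  let : MeasurableSpace (Γ.K × Γ.Hist) := ⊤
  induction m with
  | zero => exact @measurable_const _ _ _ (FF 0) (k, [])
  | succ m ih =>
    refine @measurable_to_countable' _ _ _ _ (FF (m + 1)) _ fun z => ?_
    have : (fun x => Γ.traj σ (k, x) (m + 1)) ⁻¹' {z} =
        ⋃ z' : Γ.K × Γ.Hist, ((fun x => Γ.traj σ (k, x) m) ⁻¹' {z'} ∩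
          (fun x => unif x m) ⁻¹' ((sampleOn (Γ.q z'.1 (σ z'.2))) ⁻¹'
            {y | (y.1, z'.2 ++ [(σ z'.2, y.2)]) = z})) := by
      ext x
      simp [POMDP.traj]
    rw [this]
    refine @MeasurableSet.iUnion _ _ (FF (m + 1)) _ _ fun z' => ?_
    refine @MeasurableSet.inter _ (FF (m + 1)) _ _ ?_ ?_
    · exact FF_mono (Nat.le_succ m) _ (ih trivial)
    · exact FF_unif m (measurable_sampleOn _ trivial)

noncomputable def app (σ : Γ.Strategy) (z : Γ.K × Γ.Hist) (y : Γ.K × Γ.S) : Γ.K × Γ.Hist :=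
  (y.1, z.2 ++ [(σ z.2, y.2)])

noncomputable def Pop (σ : Γ.Strategy) (Φ : Γ.K × Γ.Hist → ℝ) (z : Γ.K × Γ.Hist) : ℝ :=
  ∑ y, Γ.q z.1 (σ z.2) y * Φ (app Γ σ z y)

lemma comp_traj_meas (σ : Γ.Strategy) (k : Γ.K) (m : ℕ) (Φ : Γ.K × Γ.Hist → ℝ) :
    Measurable[FF m] (fun x => Φ (Γ.traj σ (k, x) m)) := by
  let : MeasurableSpace (Γ.K × Γ.Hist) := ⊤
  exact (measurable_from_top (f := Φ)).comp (traj_meas Γ σ k m)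

lemma integral_sample (c : Γ.K × Γ.A) (y : Γ.K × Γ.S) (m : ℕ) :
    ∫ x, ({u | sampleOn (Γ.q c.1 c.2) u = y}.indicator (fun _ => (1 : ℝ)) (unif x m)) ∂muU =
      Γ.q c.1 c.2 y := by
  have hm := measurableSet_sampleOn (Γ.q c.1 c.2) y
  rw [← integral_map (φ := fun x => unif x m) (measurable_unif m).aemeasurable
    ((measurable_const.indicator hm).aestronglyMeasurable), map_unif, integral_indicator hm]
  rw [integral_const, measureReal_restrict_apply_univ, measureReal_def,
    sampleOn_measure _ (Γ.q_nonneg _ _) (Γ.q_sum _ _),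
    ENNReal.toReal_ofReal (Γ.q_nonneg _ _ _)]
  simp

lemma step (σ : Γ.Strategy) (k : Γ.K) (m : ℕ) {F : ℝ → ℝ} (hF : Measurable[FF m] F)
    {C : ℝ} (hC : ∀ x, |F x| ≤ C) {Φ : Γ.K × Γ.Hist → ℝ} {C' : ℝ} (hC' : ∀ z, |Φ z| ≤ C') :
    ∫ x, F x * Φ (Γ.traj σ (k, x) (m + 1)) ∂muU =
      ∫ x, F x * Pop Γ σ Φ (Γ.traj σ (k, x) m) ∂muU := by
  classical
  let G : (Γ.K × Γ.A) × (Γ.K × Γ.S) → ℝ → ℝ := fun c x =>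
    F x * (if ((Γ.traj σ (k, x) m).1, σ (Γ.traj σ (k, x) m).2) = c.1 then
      Φ (app Γ σ (Γ.traj σ (k, x) m) c.2) else 0)
  let I : (Γ.K × Γ.A) × (Γ.K × Γ.S) → ℝ → ℝ := fun c x =>
    {u | sampleOn (Γ.q c.1.1 c.1.2) u = c.2}.indicator (fun _ => (1 : ℝ)) (unif x m)
  have hGm : ∀ c, Measurable[FF m] (G c) := by
    intro c
    have h := comp_traj_meas Γ σ k m (fun z =>
      if (z.1, σ z.2) = c.1 then Φ (app Γ σ z c.2) else 0)
    exact hF.mul h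
  have hGm' : ∀ c, Measurable (G c) := fun c => (hGm c).mono (FF_le m) le_rfl
  have hC0 : 0 ≤ C := (abs_nonneg _).trans (hC 0)
  have hC0' : 0 ≤ C' := (abs_nonneg _).trans (hC' (k, []))
  have hGb : ∀ c x, |G c x| ≤ C * C' := by
    intro c x
    simp only [G, abs_mul]
    refine mul_le_mul (hC x) ?_ (abs_nonneg _) hC0
    split_ifs
    · exact hC' _
    · simpa using hC0'
  have hIm0 : ∀ c : (Γ.K × Γ.A) × (Γ.K × Γ.S), Measurable
      ({u | sampleOn (Γ.q c.1.1 c.1.2) u = c.2}.indicator (fun _ => (1 : ℝ))) := fun c =>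
    measurable_const.indicator (measurableSet_sampleOn _ _)
  have hIm : ∀ c, Measurable (I c) := fun c => (hIm0 c).comp (measurable_unif m)
  have hIb : ∀ c x, |I c x| ≤ 1 := by
    intro c x
    simp only [I, Set.indicator]
    split_ifs <;> simp
  have hL : ∀ x, F x * Φ (Γ.traj σ (k, x) (m + 1)) = ∑ c, G c x * I c x := by
    intro x
    rw [Fintype.sum_prod_type, Finset.sum_eq_single
      ((Γ.traj σ (k, x) m).1, σ (Γ.traj σ (k, x) m).2)]
    · rw [Finset.sum_eq_single (sampleOn (Γ.q (Γ.traj σ (k, x) m).1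
        (σ (Γ.traj σ (k, x) m).2)) (unif x m))]
      · simp [G, I, POMDP.traj, app]
      · intro b _ hb
        simp [I, Ne.symm hb]
      · simp
    · intro b _ hb
      simp [G, Ne.symm hb]
    · simp
  have hR : ∀ x, F x * Pop Γ σ Φ (Γ.traj σ (k, x) m) = ∑ c, G c x * Γ.q c.1.1 c.1.2 c.2 := by
    intro x
    rw [Fintype.sum_prod_type, Finset.sum_eq_single
      ((Γ.traj σ (k, x) m).1, σ (Γ.traj σ (k, x) m).2)]
    · rw [Pop, Finset.mul_sum]
      refine Finset.sum_congr rfl fun y _ => ?_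
      simp [G]; ring
    · intro b _ hb
      simp [G, Ne.symm hb]
    · simp
  simp_rw [hL, hR]
  rw [integral_finsetSum, integral_finsetSum]
  · refine Finset.sum_congr rfl fun c _ => ?_
    have hind : ProbabilityTheory.IndepFun (G c) (I c) muU := by
      rw [ProbabilityTheory.IndepFun_iff_Indep]
      refine ProbabilityTheory.indep_of_indep_of_le_left
        (ProbabilityTheory.indep_of_indep_of_le_right (FF_indep m) ?_) (hGm c).comap_le
      have : I c = ({u | sampleOn (Γ.q c.1.1 c.1.2) u = c.2}.indicator (fun _ => (1 : ℝ))) ∘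
        (fun x => unif x m) := rfl
      rw [this, ← MeasurableSpace.comap_comp]
      exact MeasurableSpace.comap_mono (hIm0 c).comap_le
    rw [hind.integral_fun_mul_eq_mul_integral (hGm' c).aestronglyMeasurable
      (hIm c).aestronglyMeasurable, integral_mul_const]
    congr 1
    exact integral_sample Γ c.1 c.2 m
  · intro c _
    exact (bdd_int (hGm' c) (hGb c)).mul_const _
  · intro c _
    refine bdd_int ((hGm' c).mul (hIm c)) (C := C * C' * 1) fun x => ?_
    rw [abs_mul]
    exact mul_le_mul (hGb c x) (hIb c x) (abs_nonneg _) (by positivity)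

end Step
section Markov

variable (Γ : POMDP)

noncomputable def rr (σ : Γ.Strategy) (z : Γ.K × Γ.Hist) : ℝ := Γ.g z.1 (σ z.2)

lemma rew_eq (σ : Γ.Strategy) (ω : Γ.Env) (m : ℕ) : Γ.rew σ ω m = rr Γ σ (Γ.traj σ ω m) := rfl

lemma rr_abs (σ : Γ.Strategy) (z) : |rr Γ σ z| ≤ 1 := by
  rw [rr, abs_of_nonneg (Γ.g_nonneg _ _)]
  exact Γ.g_le_one _ _

lemma Pop_mono_of (σ : Γ.Strategy) {Φ : Γ.K × Γ.Hist → ℝ} {z} {c : ℝ}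
    (h : ∀ y, 0 < Γ.q z.1 (σ z.2) y → c ≤ Φ (app Γ σ z y)) : c ≤ Pop Γ σ Φ z := by
  have : c = ∑ y, Γ.q z.1 (σ z.2) y * c := by
    rw [← Finset.sum_mul, Γ.q_sum, one_mul]
  rw [this, Pop]
  refine Finset.sum_le_sum fun y _ => ?_
  rcases (Γ.q_nonneg z.1 (σ z.2) y).eq_or_lt with h0 | h0
  · simp [← h0]
  · exact mul_le_mul_of_nonneg_left (h y h0) h0.le

lemma Pop_neg (σ : Γ.Strategy) (Φ : Γ.K × Γ.Hist → ℝ) (z) :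
    Pop Γ σ (fun z => - Φ z) z = - Pop Γ σ Φ z := by
  simp [Pop]

lemma Pop_le_of (σ : Γ.Strategy) {Φ : Γ.K × Γ.Hist → ℝ} {z} {c : ℝ}
    (h : ∀ y, 0 < Γ.q z.1 (σ z.2) y → Φ (app Γ σ z y) ≤ c) : Pop Γ σ Φ z ≤ c := by
  have := Pop_mono_of Γ σ (Φ := fun z => - Φ z) (z := z) (c := -c)
    (fun y hy => neg_le_neg (h y hy))
  rw [Pop_neg] at this
  linarith

lemma Pop_abs (σ : Γ.Strategy) {Φ : Γ.K × Γ.Hist → ℝ} {C : ℝ} (h : ∀ z, |Φ z| ≤ C) (z) :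
    |Pop Γ σ Φ z| ≤ C :=
  abs_le.2 ⟨Pop_mono_of Γ σ fun _ _ => (abs_le.1 (h _)).1,
    Pop_le_of Γ σ fun _ _ => (abs_le.1 (h _)).2⟩

lemma iter_abs (σ : Γ.Strategy) {Φ : Γ.K × Γ.Hist → ℝ} {C : ℝ} (h : ∀ z, |Φ z| ≤ C) (i : ℕ) :
    ∀ z, |(Pop Γ σ)^[i] Φ z| ≤ C := by
  induction i with
  | zero => exact h
  | succ i ih =>
    intro z
    rw [Function.iterate_succ_apply']
    exact Pop_abs Γ σ ih z

lemma multi_step (σ : Γ.Strategy) (k : Γ.K) (m : ℕ) {F : ℝ → ℝ} (hF : Measurable[FF m] F)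
    {C : ℝ} (hC : ∀ x, |F x| ≤ C) (i : ℕ) : ∀ {Φ : Γ.K × Γ.Hist → ℝ} {C' : ℝ},
    (∀ z, |Φ z| ≤ C') →
    ∫ x, F x * Φ (Γ.traj σ (k, x) (m + i)) ∂muU =
      ∫ x, F x * (Pop Γ σ)^[i] Φ (Γ.traj σ (k, x) m) ∂muU := by
  induction i with
  | zero => intro Φ C' _; rfl
  | succ i ih =>
    intro Φ C' h
    rw [← add_assoc, step Γ σ k (m + i) (hF.mono (FF_mono (Nat.le_add_right m i)) le_rfl) hC h,
      ih (Pop_abs Γ σ h), Function.iterate_succ_apply]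

lemma comp_traj_meas' (σ : Γ.Strategy) (k : Γ.K) (m : ℕ) (Φ : Γ.K × Γ.Hist → ℝ) :
    Measurable (fun x => Φ (Γ.traj σ (k, x) m)) :=
  (comp_traj_meas Γ σ k m Φ).mono (FF_le m) le_rfl

inductive Reach (σ : Γ.Strategy) (k : Γ.K) : Γ.K × Γ.Hist → Prop
  | init : Reach σ k (k, [])
  | next (z : Γ.K × Γ.Hist) (y : Γ.K × Γ.S) (h : Reach σ k z) (hq : 0 < Γ.q z.1 (σ z.2) y) :
      Reach σ k (app Γ σ z y)

open Classical in
lemma reach_pos (σ : Γ.Strategy) (k : Γ.K) (z) (h : Reach Γ σ k z) :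
    0 < ∫ x, (if Γ.traj σ (k, x) z.2.length = z then (1 : ℝ) else 0) ∂muU := by
  induction h with
  | init => simp [POMDP.traj]
  | next z y h hq ih =>
    have hl : (app Γ σ z y).2.length = z.2.length + 1 := by simp [app]
    rw [hl]
    have hb : ∀ w, |(if w = app Γ σ z y then (1 : ℝ) else 0)| ≤ 1 := by
      intro w; split_ifs <;> simp
    have h1 := step Γ σ k z.2.length (F := fun _ => 1) measurable_const (C := 1) (by simp)
      (Φ := fun w => if w = app Γ σ z y then (1 : ℝ) else 0) hb
    simp only [one_mul] at h1
    rw [h1]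
    refine lt_of_lt_of_le (mul_pos hq ih) ?_
    rw [← integral_const_mul]
    refine integral_mono ?_ ?_ ?_
    · refine Integrable.const_mul (bdd_int (C := 1) (comp_traj_meas' Γ σ k _
        (fun w => if w = z then (1 : ℝ) else 0)) ?_) _
      intro x; split_ifs <;> simp
    · exact bdd_int (comp_traj_meas' Γ σ k _ _) (fun x => Pop_abs Γ σ hb _)
    · intro x
      simp only
      split_ifs with hx
      · rw [hx, Pop]
        refine le_trans ?_ (Finset.single_le_sum (f := fun y' => Γ.q z.1 (σ z.2) y' *
          (if app Γ σ z y' = app Γ σ z y then (1 : ℝ) else 0)) (fun i _ => mul_nonneg (Γ.q_nonneg _ _ _)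
            (by split_ifs <;> simp)) (Finset.mem_univ y))
        simp
      · rw [mul_zero]
        refine Pop_mono_of Γ σ fun y _ => ?_
        split_ifs <;> simp

open Classical in
lemma ae_reach (σ : Γ.Strategy) (k : Γ.K) :
    ∀ᵐ x ∂muU, ∀ m, Reach Γ σ k (Γ.traj σ (k, x) m) := by
  rw [ae_all_iff]
  intro m
  have hb : ∀ w, |(if Reach Γ σ k w then (0 : ℝ) else 1)| ≤ 1 := by
    intro w; split_ifs <;> simp
  have hint : ∀ m, Integrable (fun x => if Reach Γ σ k (Γ.traj σ (k, x) m) then (0 : ℝ) else 1) muU :=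
    fun m => bdd_int (C := 1) (comp_traj_meas' Γ σ k m
      (fun w => if Reach Γ σ k w then (0 : ℝ) else 1)) (fun x => hb _)
  have h0 : ∀ m, ∫ x, (if Reach Γ σ k (Γ.traj σ (k, x) m) then (0 : ℝ) else 1) ∂muU ≤ 0 := by
    intro m
    induction m with
    | zero =>
      have : ∀ x, Reach Γ σ k (Γ.traj σ (k, x) 0) := fun x => Reach.init
      simp [this]
    | succ m ih =>
      have h1 := step Γ σ k m (F := fun _ => 1) measurable_const (C := 1) (by simp)
        (Φ := fun w => if Reach Γ σ k w then (0 : ℝ) else 1) hb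
      simp only [one_mul] at h1
      rw [h1]
      refine le_trans (integral_mono ?_ (hint m) ?_) ih
      · exact bdd_int (comp_traj_meas' Γ σ k _ _) (fun x => Pop_abs Γ σ hb _)
      · intro x
        simp only
        refine Pop_le_of Γ σ fun y hy => ?_
        split_ifs with ha hb' hc
        · exact le_rfl
        · norm_num
        · exact absurd (Reach.next _ _ hc hy) ha
        · exact le_rfl
  have h1 : ∫ x, (if Reach Γ σ k (Γ.traj σ (k, x) m) then (0 : ℝ) else 1) ∂muU = 0 :=
    le_antisymm (h0 m) (integral_nonneg fun x => by simp only [Pi.zero_apply]; split_ifs <;> simp)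
  rw [integral_eq_zero_iff_of_nonneg (fun x => by simp only [Pi.zero_apply]; split_ifs <;> simp)
    (hint m)] at h1
  filter_upwards [h1] with x hx
  by_contra hc
  simp [hc] at hx

noncomputable def GG (σ : Γ.Strategy) (n : ℕ) (z : Γ.K × Γ.Hist) : ℝ :=
  ∑ i ∈ Finset.range n, (Pop Γ σ)^[i] (rr Γ σ) z

lemma GG_succ (σ : Γ.Strategy) (n : ℕ) (z) :
    GG Γ σ (n + 1) z = rr Γ σ z + Pop Γ σ (GG Γ σ n) z := by
  have h : Pop Γ σ (GG Γ σ n) z = ∑ i ∈ Finset.range n, Pop Γ σ ((Pop Γ σ)^[i] (rr Γ σ)) z := by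
    simp only [Pop, GG, Finset.mul_sum]
    rw [Finset.sum_comm]
  rw [h, GG, Finset.sum_range_succ', add_comm]
  simp only [Function.iterate_succ_apply', Function.iterate_zero, id]

lemma GG_abs (σ : Γ.Strategy) (n : ℕ) (z) : |GG Γ σ n z| ≤ n := by
  refine (Finset.abs_sum_le_sum_abs _ _).trans ?_
  refine (Finset.sum_le_sum fun i _ => iter_abs Γ σ (rr_abs Γ σ) i z).trans ?_
  simp

lemma shift_tendsto (f : ℕ → ℝ) (m : ℕ) (c : ℝ)
    (h : Tendsto (fun n : ℕ => (1 / n : ℝ) * ∑ i ∈ Finset.range n, f i) atTop (nhds c)) :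
    Tendsto (fun n : ℕ => (1 / n : ℝ) * ∑ i ∈ Finset.range n, f (m + i)) atTop (nhds c) := by
  have h1 := (tendsto_add_atTop_iff_nat m).2 h
  have h2 : Tendsto (fun n : ℕ => (1 : ℝ) + (m : ℝ) * (1 / n)) atTop (nhds 1) := by
    simpa using (tendsto_one_div_atTop_nhds_zero_nat (𝕜 := ℝ)).const_mul (m : ℝ) |>.const_add 1
  have h3 : Tendsto (fun n : ℕ => (1 / n : ℝ) * ∑ i ∈ Finset.range m, f i) atTop (nhds 0) := by
    simpa using (tendsto_one_div_atTop_nhds_zero_nat (𝕜 := ℝ)).mul_const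
      (∑ i ∈ Finset.range m, f i)
  have h4 := (h2.mul h1).sub h3
  rw [one_mul, sub_zero] at h4
  refine h4.congr' ?_
  filter_upwards [eventually_gt_atTop 0] with n hn
  have hn' : (n : ℝ) ≠ 0 := by positivity
  have hn2 : ((n + m : ℕ) : ℝ) ≠ 0 := by positivity
  rw [add_comm n m, Finset.sum_range_add]
  push_cast at hn2 ⊢
  rw [add_comm] at hn2
  field_simp
  ring

open Classical in
lemma reach_limit (σ : Γ.Strategy) (k : Γ.K) (c : ℝ)
    (h : ∀ᵐ x ∂muU, Tendsto (Γ.avg σ (k, x)) atTop (nhds c)) (z) (hz : Reach Γ σ k z) :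
    Tendsto (fun n : ℕ => (1 / n : ℝ) * GG Γ σ n z) atTop (nhds c) := by
  have hP := reach_pos Γ σ k z hz
  set m := z.2.length with hm
  set F : ℝ → ℝ := fun x => if Γ.traj σ (k, x) m = z then (1 : ℝ) else 0 with hFdef
  have hFm : Measurable[FF m] F := comp_traj_meas Γ σ k m (fun w => if w = z then (1 : ℝ) else 0)
  have hFb : ∀ x, |F x| ≤ 1 := by
    intro x; simp only [F]; split_ifs <;> simp
  have hFm' : Measurable F := hFm.mono (FF_le m) le_rfl
  set P := ∫ x, F x ∂muU with hPdef
  have e1 : ∀ i, ∫ x, F x * Γ.rew σ (k, x) (m + i) ∂muU = P * (Pop Γ σ)^[i] (rr Γ σ) z := by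
    intro i
    simp_rw [rew_eq]
    rw [multi_step Γ σ k m hFm hFb i (rr_abs Γ σ), hPdef, ← integral_mul_const]
    congr 1
    ext x
    simp only [F]
    split_ifs with hx
    · rw [hx]
    · simp
  have hrm : ∀ i, Measurable (fun x => Γ.rew σ (k, x) i) := fun i =>
    comp_traj_meas' Γ σ k i (rr Γ σ)
  have e2 : ∀ n : ℕ, ∫ x, F x * ((1 / n : ℝ) * ∑ i ∈ Finset.range n, Γ.rew σ (k, x) (m + i)) ∂muU =
      P * ((1 / n : ℝ) * GG Γ σ n z) := by
    intro n
    have : ∀ x, F x * ((1 / n : ℝ) * ∑ i ∈ Finset.range n, Γ.rew σ (k, x) (m + i)) =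
        (1 / n : ℝ) * ∑ i ∈ Finset.range n, F x * Γ.rew σ (k, x) (m + i) := by
      intro x; rw [← Finset.mul_sum]; ring
    simp_rw [this]
    rw [integral_const_mul, integral_finsetSum]
    · simp_rw [e1]
      rw [← Finset.mul_sum, GG]; ring
    · intro i _
      refine bdd_int (hFm'.mul (hrm _)) (C := 1 * 1) fun x => ?_
      rw [abs_mul]
      exact mul_le_mul (hFb x) (rr_abs Γ σ _) (abs_nonneg _) zero_le_one
  have h5 : Tendsto (fun n : ℕ => ∫ x, F x * ((1 / n : ℝ) *
      ∑ i ∈ Finset.range n, Γ.rew σ (k, x) (m + i)) ∂muU) atTop (nhds (∫ x, F x * c ∂muU)) := by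
    refine tendsto_integral_of_dominated_convergence (fun _ => 1) ?_ (integrable_const _) ?_ ?_
    · intro n
      exact (hFm'.mul ((Finset.measurable_sum _ fun i _ => hrm (m + i)).const_mul _)).aestronglyMeasurable
    · intro n
      refine ae_of_all _ fun x => ?_
      rw [Real.norm_eq_abs, abs_mul, abs_mul]
      refine mul_le_one₀ (hFb x) (by positivity) ?_
      have : |∑ i ∈ Finset.range n, Γ.rew σ (k, x) (m + i)| ≤ n := by
        refine (Finset.abs_sum_le_sum_abs _ _).trans ?_
        refine (Finset.sum_le_sum fun i _ => rr_abs Γ σ _).trans ?_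
        simp
      rw [abs_of_nonneg (by positivity), one_div]
      rcases Nat.eq_zero_or_pos n with h0 | h0
      · simp [h0]
      · rw [inv_mul_le_iff₀ (by positivity), mul_one]
        exact this
    · filter_upwards [h] with x hx
      exact (shift_tendsto _ m c hx).const_mul _
  simp_rw [e2] at h5
  rw [integral_mul_const, ← hPdef] at h5
  have h6 := h5.const_mul P⁻¹
  simp_rw [← mul_assoc P⁻¹, inv_mul_cancel₀ hP.ne', one_mul] at h6
  exact h6

end Markov
section Drift

variable (Γ : POMDP)

lemma avg_nonneg (τ : Γ.Strategy) (ω : Γ.Env) (n : ℕ) : 0 ≤ Γ.avg τ ω n :=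
  mul_nonneg (by positivity) (Finset.sum_nonneg fun _ _ => Γ.g_nonneg _ _)

lemma avg_le_one (τ : Γ.Strategy) (ω : Γ.Env) (n : ℕ) : Γ.avg τ ω n ≤ 1 := by
  have : ∑ m ∈ Finset.range n, Γ.rew τ ω m ≤ n := by
    refine (Finset.sum_le_sum fun i _ => Γ.g_le_one _ _).trans ?_
    simp
  rw [POMDP.avg, one_div]
  rcases Nat.eq_zero_or_pos n with h0 | h0
  · simp [h0]
  · rw [inv_mul_le_iff₀ (by positivity), mul_one]
    exact this

lemma avg_cobdd (τ : Γ.Strategy) (ω : Γ.Env) :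
    atTop.IsCoboundedUnder (· ≥ ·) (Γ.avg τ ω) :=
  (isBoundedUnder_of ⟨1, fun n => avg_le_one Γ τ ω n⟩ :
    atTop.IsBoundedUnder (· ≤ ·) (Γ.avg τ ω)).isCoboundedUnder_flip

lemma avg_bdd (τ : Γ.Strategy) (ω : Γ.Env) :
    atTop.IsBoundedUnder (· ≥ ·) (Γ.avg τ ω) :=
  isBoundedUnder_of ⟨0, fun n => avg_nonneg Γ τ ω n⟩

lemma ae_of_geom {W : ℕ → ℝ → ℝ} (hm : ∀ n, Measurable (W n)) (h0 : ∀ n x, 0 ≤ W n x)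
    (hi : ∀ n, Integrable (W n) muU) {ρ C : ℝ} (hρ0 : 0 ≤ ρ) (hρ : ρ < 1)
    (h : ∀ n, ∫ x, W n x ∂muU ≤ C * ρ ^ n) :
    ∀ᵐ x ∂muU, ∀ᶠ n in atTop, W n x < 1 := by
  have hs : Summable (fun n => C * ρ ^ n) := (summable_geometric_of_lt_one hρ0 hρ).mul_left C
  have h1 : ∫⁻ x, ∑' n, ENNReal.ofReal (W n x) ∂muU ≠ ⊤ := by
    rw [lintegral_tsum (fun n => (hm n).ennreal_ofReal.aemeasurable)]
    have h2 : ∀ n, ∫⁻ x, ENNReal.ofReal (W n x) ∂muU ≤ ENNReal.ofReal (C * ρ ^ n) := by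
      intro n
      rw [← ofReal_integral_eq_lintegral_ofReal (hi n) (ae_of_all _ (h0 n))]
      exact ENNReal.ofReal_le_ofReal (h n)
    exact ne_top_of_le_ne_top hs.tsum_ofReal_ne_top (ENNReal.tsum_le_tsum h2)
  have h3 := ae_lt_top (Measurable.tsum fun n => (hm n).ennreal_ofReal) h1
  filter_upwards [h3] with x hx
  have h4 := ENNReal.tendsto_atTop_zero_of_tsum_ne_top hx.ne
  have h5 := h4.eventually (gt_mem_nhds (show (0 : ENNReal) < 1 by simp))
  filter_upwards [h5] with n hn
  rwa [ENNReal.ofReal_lt_one] at hn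

lemma exp_bound {x l B : ℝ} (hx : |x| ≤ B) (hl : 0 < l) (hlB : l * B ≤ 1) :
    Real.exp (-(l * x)) ≤ 1 - l * x + l ^ 2 * B ^ 2 := by
  have h1 : |-(l * x)| ≤ 1 := by
    rw [abs_neg, abs_mul, abs_of_pos hl]
    exact (mul_le_mul_of_nonneg_left hx hl.le).trans hlB
  have h2 := (abs_le.1 (Real.abs_exp_sub_one_sub_id_le h1)).2
  have h3 : x ^ 2 ≤ B ^ 2 := by
    rw [← sq_abs x]
    exact pow_le_pow_left₀ (abs_nonneg _) hx 2
  have h4 : (-(l * x)) ^ 2 ≤ l ^ 2 * B ^ 2 := by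
    rw [neg_sq, mul_pow]
    exact mul_le_mul_of_nonneg_left h3 (by positivity)
  linarith

lemma drift (τ : Γ.Strategy) (k : Γ.K) (U : Γ.K × Γ.Hist → ℝ) (M : ℝ) (hU : ∀ z, |U z| ≤ M)
    (c ε : ℝ) (hε : 0 < ε)
    (hd : ∀ z, Reach Γ τ k z → c ≤ rr Γ τ z + Pop Γ τ U z - U z) :
    ∀ᵐ x ∂muU, c - 2 * ε ≤ atTop.liminf (Γ.avg τ (k, x)) := by
  have hM : 0 ≤ M := (abs_nonneg _).trans (hU (k, []))
  set B : ℝ := 1 + |c| + 2 * M + ε with hB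
  have hB1 : ε ≤ B := by have := abs_nonneg c; linarith
  have hB0 : 0 < B := by linarith
  set l : ℝ := ε / (2 * B ^ 2) with hl
  have hl0 : 0 < l := by positivity
  have hlB : l * B ≤ 1 := by
    rw [hl, div_mul_eq_mul_div, div_le_one (by positivity)]
    nlinarith
  set ρ : ℝ := 1 - l * ε + l ^ 2 * B ^ 2 with hρ
  have e1 : l ^ 2 * B ^ 2 = l * ε / 2 := by
    rw [hl]; field_simp
  have hρ1 : ρ < 1 := by
    have : 0 < l * ε := by positivity
    rw [hρ, e1]; linarith
  have hρ0 : 0 ≤ ρ := by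
    have : l * ε ≤ l * B := mul_le_mul_of_nonneg_left hB1 hl0.le
    rw [hρ]; nlinarith [sq_nonneg (l * B)]
  set c1 := c - ε with hc1
  let S : ℕ → ℝ → ℝ := fun n x => ∑ i ∈ Finset.range n, (Γ.rew τ (k, x) i - c1)
  let Φ : Γ.K × Γ.Hist → ℝ := fun z => Real.exp (-(l * U z))
  let W : ℕ → ℝ → ℝ := fun n x => Real.exp (-(l * S n x)) * Φ (Γ.traj τ (k, x) n)
  have hSF' : ∀ n m, n ≤ m + 1 → Measurable[FF m] (S n) := by
    intro n m hnm
    refine @Finset.measurable_sum _ _ _ _ _ _ (FF m) _ _ fun i hi => ?_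
    have h1 : Measurable[FF m] (fun x => Γ.rew τ (k, x) i) :=
      (comp_traj_meas Γ τ k i (rr Γ τ)).mono
        (FF_mono (by have := Finset.mem_range.1 hi; omega)) le_rfl
    exact h1.sub_const c1
  have hEF : ∀ n m, n ≤ m + 1 → Measurable[FF m] (fun x => Real.exp (-(l * S n x))) := by
    intro n m hnm
    exact Real.measurable_exp.comp (((hSF' n m hnm).const_mul l).neg)
  have hSb : ∀ n x, |S n x| ≤ n * (1 + |c1|) := by
    intro n x
    refine (Finset.abs_sum_le_sum_abs _ _).trans ?_
    refine (Finset.sum_le_sum (g := fun _ => 1 + |c1|) fun i _ => ?_).trans ?_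
    · exact (abs_sub _ _).trans (add_le_add (rr_abs Γ τ _) le_rfl)
    · rw [Finset.sum_const, Finset.card_range, nsmul_eq_mul]
  have hEb : ∀ n x, |Real.exp (-(l * S n x))| ≤ Real.exp (l * (n * (1 + |c1|))) := by
    intro n x
    rw [abs_of_pos (Real.exp_pos _), Real.exp_le_exp, ← mul_neg]
    exact mul_le_mul_of_nonneg_left ((neg_le_abs _).trans (hSb n x)) hl0.le
  have hΦb : ∀ z, |Φ z| ≤ Real.exp (l * M) := by
    intro z
    simp only [Φ]
    rw [abs_of_pos (Real.exp_pos _), Real.exp_le_exp, ← mul_neg]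
    exact mul_le_mul_of_nonneg_left ((neg_le_abs _).trans (hU z)) hl0.le
  have hWm : ∀ n, Measurable (W n) := fun n =>
    ((hEF n n (Nat.le_succ n)).mono (FF_le n) le_rfl).mul (comp_traj_meas' Γ τ k n Φ)
  have hWi : ∀ n, Integrable (W n) muU := by
    intro n
    refine bdd_int (hWm n) (C := Real.exp (l * (n * (1 + |c1|))) * Real.exp (l * M)) fun x => ?_
    simp only [W, abs_mul]
    exact mul_le_mul (hEb n x) (hΦb _) (abs_nonneg _) (Real.exp_pos _).le
  have hone : ∀ z, Reach Γ τ k z →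
      Real.exp (-(l * (rr Γ τ z - c1))) * Pop Γ τ Φ z ≤ ρ * Φ z := by
    intro z hz
    have hb : ∀ y, Real.exp (-(l * (rr Γ τ z - c1))) * Φ (app Γ τ z y) ≤
        Φ z * (1 - l * (rr Γ τ z - c1 + U (app Γ τ z y) - U z) + l ^ 2 * B ^ 2) := by
      intro y
      have h1 : |rr Γ τ z - c1 + U (app Γ τ z y) - U z| ≤ B := by
        have a1 := abs_le.1 (rr_abs Γ τ z)
        have a2 := abs_le.1 (hU (app Γ τ z y))
        have a3 := abs_le.1 (hU z)
        have a4 := neg_abs_le c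
        have a5 := le_abs_self c
        rw [hB, hc1, abs_le]
        constructor <;> linarith
      have h2 := exp_bound h1 hl0 hlB
      refine le_trans (le_of_eq ?_) (mul_le_mul_of_nonneg_left h2 (Real.exp_pos _).le)
      simp only [Φ]
      rw [← Real.exp_add, ← Real.exp_add]
      congr 1; ring
    have hsum : Real.exp (-(l * (rr Γ τ z - c1))) * Pop Γ τ Φ z ≤
        Φ z * (1 - l * (rr Γ τ z - c1 + Pop Γ τ U z - U z) + l ^ 2 * B ^ 2) := by
      have e2 : Φ z * (1 - l * (rr Γ τ z - c1 + Pop Γ τ U z - U z) + l ^ 2 * B ^ 2) =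
          ∑ y, Γ.q z.1 (τ z.2) y *
            (Φ z * (1 - l * (rr Γ τ z - c1 + U (app Γ τ z y) - U z) + l ^ 2 * B ^ 2)) := by
        have e3 : ∀ y, Γ.q z.1 (τ z.2) y *
            (Φ z * (1 - l * (rr Γ τ z - c1 + U (app Γ τ z y) - U z) + l ^ 2 * B ^ 2)) =
            Γ.q z.1 (τ z.2) y * (Φ z * (1 - l * (rr Γ τ z - c1 - U z) + l ^ 2 * B ^ 2)) -
            (Γ.q z.1 (τ z.2) y * U (app Γ τ z y)) * (Φ z * l) := by
          intro y; ring
        simp_rw [e3]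
        rw [Finset.sum_sub_distrib, ← Finset.sum_mul, ← Finset.sum_mul, Γ.q_sum, Pop]
        ring
      rw [e2, Pop, Finset.mul_sum]
      refine Finset.sum_le_sum fun y _ => ?_
      rw [mul_left_comm]
      exact mul_le_mul_of_nonneg_left (hb y) (Γ.q_nonneg _ _ _)
    refine hsum.trans ?_
    rw [mul_comm]
    refine mul_le_mul_of_nonneg_right ?_ (Real.exp_pos _).le
    have h7 : ε ≤ rr Γ τ z - c1 + Pop Γ τ U z - U z := by
      have := hd z hz
      rw [hc1]; linarith
    have := mul_le_mul_of_nonneg_left h7 hl0.le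
    rw [hρ]; linarith
  have hrec : ∀ n, ∫ x, W (n + 1) x ∂muU ≤ ρ * ∫ x, W n x ∂muU := by
    intro n
    simp only [W]
    rw [step Γ τ k n (hEF (n + 1) n le_rfl) (hEb (n + 1)) hΦb, ← integral_const_mul]
    refine integral_mono_ae ?_ ((hWi n).const_mul ρ) ?_
    · refine bdd_int (C := Real.exp (l * ((n + 1 : ℕ) * (1 + |c1|))) * Real.exp (l * M))
        (((hEF (n + 1) n le_rfl).mono (FF_le n) le_rfl).mul (comp_traj_meas' Γ τ k n _)) fun x => ?_
      rw [abs_mul]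
      exact mul_le_mul (hEb (n + 1) x) (Pop_abs Γ τ hΦb _) (abs_nonneg _) (Real.exp_pos _).le
    · filter_upwards [ae_reach Γ τ k] with x hx
      have h8 := hone _ (hx n)
      have h9 : Real.exp (-(l * S (n + 1) x)) = Real.exp (-(l * S n x)) *
          Real.exp (-(l * (rr Γ τ (Γ.traj τ (k, x) n) - c1))) := by
        rw [← Real.exp_add]
        simp only [S]
        rw [Finset.sum_range_succ, rew_eq]
        congr 1; ring
      rw [h9, mul_assoc]
      refine (mul_le_mul_of_nonneg_left h8 (Real.exp_pos _).le).trans (le_of_eq ?_)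
      ring
  have hgeo : ∀ n, ∫ x, W n x ∂muU ≤ (∫ x, W 0 x ∂muU) * ρ ^ n := by
    intro n
    induction n with
    | zero => simp
    | succ n ih =>
      refine (hrec n).trans ((mul_le_mul_of_nonneg_left ih hρ0).trans (le_of_eq ?_))
      ring
  have hfin := ae_of_geom hWm (fun n x => mul_nonneg (Real.exp_pos _).le (Real.exp_pos _).le)
    hWi hρ0 hρ1 hgeo
  filter_upwards [hfin] with x hx
  refine le_liminf_of_le (avg_cobdd Γ τ (k, x)) ?_
  obtain ⟨N0, hN0⟩ := exists_nat_gt (M / ε)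
  filter_upwards [hx, eventually_ge_atTop (N0 + 1)] with n hn hnN
  have hn0 : (0 : ℝ) < n := by
    have : 0 < n := by omega
    exact_mod_cast this
  simp only [W, Φ] at hn
  rw [← Real.exp_add, Real.exp_lt_one_iff] at hn
  have h10 : 0 < S n x + U (Γ.traj τ (k, x) n) := by
    by_contra hc
    push Not at hc
    nlinarith
  have h11 : S n x = ∑ i ∈ Finset.range n, Γ.rew τ (k, x) i - n * c1 := by
    simp only [S]
    rw [Finset.sum_sub_distrib]; simp
  have h12 := (abs_le.1 (hU (Γ.traj τ (k, x) n))).2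
  have h13 : M < n * ε := by
    rw [div_lt_iff₀ hε] at hN0
    have : (N0 : ℝ) ≤ n := by exact_mod_cast (by omega : N0 ≤ n)
    nlinarith
  rw [POMDP.avg, one_div, le_inv_mul_iff₀ hn0]
  rw [hc1] at h11
  nlinarith

end Drift
section Final

variable (Γ : POMDP)

lemma measurable_avg (τ : Γ.Strategy) (n : ℕ) : Measurable (fun ω : Γ.Env => Γ.avg τ ω n) := by
  refine measurable_from_prod_countable_right fun k => ?_
  unfold POMDP.avg
  exact (Finset.measurable_sum _ fun i _ => comp_traj_meas' Γ τ k i (rr Γ τ)).const_mul _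

lemma measurable_liminf_avg (τ : Γ.Strategy) :
    Measurable (fun ω : Γ.Env => atTop.liminf (Γ.avg τ ω)) :=
  Measurable.liminf (f := fun n (ω : Γ.Env) => Γ.avg τ ω n) (measurable_avg Γ τ)

lemma liminf_abs (τ : Γ.Strategy) (ω : Γ.Env) : |atTop.liminf (Γ.avg τ ω)| ≤ 1 := by
  have h1 : 0 ≤ atTop.liminf (Γ.avg τ ω) :=
    le_liminf_of_le (avg_cobdd Γ τ ω) (Eventually.of_forall (avg_nonneg Γ τ ω))
  rw [abs_of_nonneg h1]
  exact liminf_le_of_frequently_le (Frequently.of_forall (avg_le_one Γ τ ω)) (avg_bdd Γ τ ω)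

noncomputable def Lk (τ : Γ.Strategy) (k : Γ.K) : ℝ :=
  ∫ x, atTop.liminf (Γ.avg τ (k, x)) ∂muU

instance (p : Γ.K → ℝ) : IsFiniteMeasure (vecMeasure p) := by
  refine ⟨?_⟩
  simp [vecMeasure, ENNReal.sum_lt_top]

lemma pay_eq (τ : Γ.Strategy) (p : Γ.K → ℝ) (hp : ∀ k, 0 ≤ p k) :
    Γ.pay p τ = ∑ k, p k * Lk Γ τ k := by
  unfold POMDP.pay POMDP.envMeasure
  rw [integral_prod]
  · unfold vecMeasure
    rw [integral_finsetSum_measure]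
    · refine Finset.sum_congr rfl fun k _ => ?_
      rw [integral_smul_measure, integral_dirac, ENNReal.toReal_ofReal (hp k)]
      rfl
    · intro k _
      refine Integrable.smul_measure ?_ ENNReal.ofReal_ne_top
      exact integrable_dirac (by simp)
  · exact Integrable.of_bound (measurable_liminf_avg Γ τ).aestronglyMeasurable 1
      (ae_of_all _ (liminf_abs Γ τ))

lemma payK_eq (τ : Γ.Strategy) (k : Γ.K) : Γ.payK k τ = Lk Γ τ k := by
  rw [POMDP.payK, pay_eq Γ τ _ (fun k' => by unfold diracBelief; split_ifs <;> simp)]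
  simp [diracBelief]

lemma ae_env (k : Γ.K) (Q : Γ.Env → Prop) (h : ∀ᵐ ω ∂(Γ.envMeasure (diracBelief k)), Q ω) :
    ∀ᵐ x ∂muU, Q (k, x) := by
  have hv : vecMeasure (diracBelief k) = Measure.dirac k := by
    unfold vecMeasure
    rw [Finset.sum_eq_single k]
    · simp [diracBelief]
    · intro b _ hb
      simp [diracBelief, hb]
    · simp
  unfold POMDP.envMeasure at h
  rw [hv] at h
  have h1 := Measure.ae_ae_of_ae_prod h
  rw [ae_dirac_eq] at h1
  exact h1

lemma finiteMemory_of {M : Type*} (S : Set M) (hS : S.Finite) (m0 : M) (hm0 : m0 ∈ S)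
    (f : M → Γ.A) (u : M → Γ.A × Γ.S → M) (hu : ∀ m ∈ S, ∀ c, u m c ∈ S) :
    Γ.FiniteMemory (fun h => f (h.foldl u m0)) := by
  classical
  have := hS.fintype
  let e := Fintype.equivFin S
  refine ⟨Fintype.card S, e ⟨m0, hm0⟩, fun i => f (e.symm i).1,
    fun i c => e ⟨u (e.symm i).1 c, hu _ (e.symm i).2 c⟩, fun h => ?_⟩
  have key : ∀ (h : Γ.Hist) (m : S), h.foldl u m.1 =
      (e.symm (h.foldl (fun i c => e ⟨u (e.symm i).1 c, hu _ (e.symm i).2 c⟩) (e m))).1 := by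
    intro h
    induction h with
    | nil => intro m; simp
    | cons c h ih =>
      intro m
      simp only [List.foldl_cons]
      have := ih ⟨u m.1 c, hu _ m.2 c⟩
      simp only at this
      rw [this]
      simp
  simp only
  rw [key h ⟨m0, hm0⟩]

def TT (pstar : Γ.K → ℝ) (σ : Γ.Strategy) (h : Γ.Hist) : Set (Γ.K × Γ.K) :=
  {c | 0 < pstar c.1 ∧ Reach Γ σ c.1 (c.2, h)}

open Classical in
noncomputable def rep (pstar : Γ.K → ℝ) (σ : Γ.Strategy) (t : Set (Γ.K × Γ.K)) : Γ.Hist :=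
  if h : ∃ h, TT Γ pstar σ h = t then h.choose else []

lemma TT_rep (pstar : Γ.K → ℝ) (σ : Γ.Strategy) (h : Γ.Hist) :
    TT Γ pstar σ (rep Γ pstar σ (TT Γ pstar σ h)) = TT Γ pstar σ h := by
  have hex : ∃ h', TT Γ pstar σ h' = TT Γ pstar σ h := ⟨h, rfl⟩
  rw [rep, dif_pos hex]
  exact hex.choose_spec

noncomputable def upd (pstar : Γ.K → ℝ) (σ : Γ.Strategy) (N : ℕ) (m : Γ.Hist × ℕ)
    (c : Γ.A × Γ.S) : Γ.Hist × ℕ :=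
  if m.2 + 1 < N then (m.1 ++ [c], m.2 + 1)
  else (rep Γ pstar σ (TT Γ pstar σ (m.1 ++ [c])), 0)

noncomputable def mem (pstar : Γ.K → ℝ) (σ : Γ.Strategy) (N : ℕ) (H : Γ.Hist) : Γ.Hist × ℕ :=
  H.foldl (upd Γ pstar σ N) (rep Γ pstar σ (TT Γ pstar σ []), 0)

noncomputable def newS (pstar : Γ.K → ℝ) (σ : Γ.Strategy) (N : ℕ) : Γ.Strategy :=
  fun H => σ (mem Γ pstar σ N H).1

lemma mem_append (pstar : Γ.K → ℝ) (σ : Γ.Strategy) (N : ℕ) (H : Γ.Hist) (c : Γ.A × Γ.S) :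
    mem Γ pstar σ N (H ++ [c]) = upd Γ pstar σ N (mem Γ pstar σ N H) c := by
  simp [mem]

lemma newS_fin (pstar : Γ.K → ℝ) (σ : Γ.Strategy) (N : ℕ) (hN : 0 < N) :
    Γ.FiniteMemory (newS Γ pstar σ N) := by
  refine finiteMemory_of Γ ((fun c : Set (Γ.K × Γ.K) × Γ.Hist =>
    (rep Γ pstar σ c.1 ++ c.2, c.2.length)) '' (Set.univ ×ˢ {l | l.length < N})) ?_
    (rep Γ pstar σ (TT Γ pstar σ []), 0) ?_ (fun m => σ m.1) (upd Γ pstar σ N) ?_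
  · exact (Set.finite_univ.prod (List.finite_length_lt _ N)).image _
  · exact ⟨(TT Γ pstar σ [], []), ⟨trivial, by simpa using hN⟩, by simp⟩
  · rintro _ ⟨⟨t, l⟩, ⟨-, hl⟩, rfl⟩ c
    simp only [upd]
    split_ifs with h
    · exact ⟨(t, l ++ [c]), ⟨trivial, by simpa using h⟩, by simp⟩
    · exact ⟨(TT Γ pstar σ (rep Γ pstar σ t ++ l ++ [c]), []), ⟨trivial, by simpa using hN⟩, by simp⟩

lemma inv_reach (pstar : Γ.K → ℝ) (σ : Γ.Strategy) (N : ℕ) (hN : 0 < N) (k : Γ.K)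
    (hk : 0 < pstar k) (z) (hz : Reach Γ (newS Γ pstar σ N) k z) :
    Reach Γ σ k (z.1, (mem Γ pstar σ N z.2).1) ∧ (mem Γ pstar σ N z.2).2 < N := by
  have conv : ∀ (k' : Γ.K) (h : Γ.Hist), Reach Γ σ k (k', h) →
      Reach Γ σ k (k', rep Γ pstar σ (TT Γ pstar σ h)) := by
    intro k' h hr
    have h1 : (k, k') ∈ TT Γ pstar σ h := ⟨hk, hr⟩
    rw [← TT_rep] at h1
    exact h1.2
  induction hz with
  | init => exact ⟨conv _ _ Reach.init, hN⟩
  | next z y h hq ih =>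
    have h1 : Reach Γ σ k (app Γ σ (z.1, (mem Γ pstar σ N z.2).1) y) := Reach.next _ _ ih.1 hq
    simp only [app] at h1 ⊢
    rw [mem_append]
    simp only [upd]
    split_ifs with h2
    · exact ⟨h1, h2⟩
    · exact ⟨conv _ _ h1, hN⟩

end Final

/-- If the strategy `σ` has a.s. convergent average rewards from every state in the
support of `p*`, then for every `ε > 0` there is a finite-memory strategy `σ'` with
`γ^{p*}_∞(σ') ≥ γ^{p*}_∞(σ) - ε`. -/
theorem pomdp_finiteMemory_from_ergodic (Γ : POMDP)
    (pstar : Γ.K → ℝ) (hps : IsBelief pstar) (σ : Γ.Strategy)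
    (herg : ∀ k, 0 < pstar k →
      ∀ᵐ ω ∂(Γ.envMeasure (diracBelief k)),
        Tendsto (Γ.avg σ ω) atTop (nhds (Γ.payK k σ)))
    (ε : ℝ) (hε : 0 < ε) :
    ∃ σ' : Γ.Strategy, Γ.FiniteMemory σ' ∧
      Γ.pay pstar σ' ≥ Γ.pay pstar σ - ε := by
  have hlim : ∀ k, 0 < pstar k → ∀ z, Reach Γ σ k z →
      Tendsto (fun n : ℕ => (1 / n : ℝ) * GG Γ σ n z) atTop (nhds (Lk Γ σ k)) := by
    intro k hk z hz
    refine reach_limit Γ σ k _ ?_ z hz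
    have := ae_env Γ k _ (herg k hk)
    rwa [payK_eq] at this
  have hε3 : 0 < ε / 3 := by positivity
  have hev : ∀ᶠ N : ℕ in atTop, ∀ (t : Set (Γ.K × Γ.K)) (k k' : Γ.K), 0 < pstar k →
      Reach Γ σ k (k', rep Γ pstar σ t) →
      Lk Γ σ k - ε / 3 ≤ (1 / N : ℝ) * GG Γ σ N (k', rep Γ pstar σ t) := by
    rw [eventually_all]; intro t
    rw [eventually_all]; intro k
    rw [eventually_all]; intro k'
    by_cases hk : 0 < pstar k
    · by_cases hr : Reach Γ σ k (k', rep Γ pstar σ t)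
      · filter_upwards [(hlim k hk _ hr).eventually (lt_mem_nhds (sub_lt_self _ hε3))] with N hN _ _
        exact hN.le
      · exact Eventually.of_forall fun N _ h => absurd h hr
    · exact Eventually.of_forall fun N h => absurd h hk
  obtain ⟨N, hNev, hN⟩ := (hev.and (eventually_gt_atTop 0)).exists
  have hN' : (0 : ℝ) < N := by exact_mod_cast hN
  refine ⟨newS Γ pstar σ N, newS_fin Γ pstar σ N hN, ?_⟩
  have main : ∀ k, 0 < pstar k → Lk Γ σ k - ε ≤ Lk Γ (newS Γ pstar σ N) k := by
    intro k hk
    set c := Lk Γ σ k - ε / 3 with hc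
    let U : Γ.K × Γ.Hist → ℝ := fun z =>
      GG Γ σ (N - (mem Γ pstar σ N z.2).2) (z.1, (mem Γ pstar σ N z.2).1) -
        ((N - (mem Γ pstar σ N z.2).2 : ℕ) : ℝ) * c
    have hU : ∀ z, |U z| ≤ N + N * |c| := by
      intro z
      have h1 : ((N - (mem Γ pstar σ N z.2).2 : ℕ) : ℝ) ≤ N := by
        exact_mod_cast Nat.sub_le _ _
      refine (abs_sub _ _).trans (add_le_add ((GG_abs Γ σ _ _).trans h1) ?_)
      rw [abs_mul, abs_of_nonneg (Nat.cast_nonneg _)]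
      exact mul_le_mul_of_nonneg_right h1 (abs_nonneg _)
    have hd : ∀ z, Reach Γ (newS Γ pstar σ N) k z →
        c ≤ rr Γ (newS Γ pstar σ N) z + Pop Γ (newS Γ pstar σ N) U z - U z := by
      intro z hz
      obtain ⟨hr, hj⟩ := inv_reach Γ pstar σ N hN k hk z hz
      set h := (mem Γ pstar σ N z.2).1 with hh
      set j := (mem Γ pstar σ N z.2).2 with hjdef
      have hrr : rr Γ (newS Γ pstar σ N) z = rr Γ σ (z.1, h) := rfl
      obtain ⟨n, hn⟩ : ∃ n, N - j = n + 1 := ⟨N - j - 1, by omega⟩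
      have hUz : U z = rr Γ σ (z.1, h) + Pop Γ σ (GG Γ σ n) (z.1, h) - ((n : ℝ) + 1) * c := by
        simp only [U]
        rw [← hjdef, ← hh, hn, GG_succ]
        push_cast; ring
      rw [hrr, hUz]
      suffices hs : Pop Γ σ (GG Γ σ n) (z.1, h) - n * c ≤ Pop Γ (newS Γ pstar σ N) U z by
        linarith
      by_cases h2 : j + 1 < N
      · have e : ∀ y, U (app Γ (newS Γ pstar σ N) z y) = GG Γ σ n (app Γ σ (z.1, h) y) - n * c := by
          intro y
          have e1 : mem Γ pstar σ N (app Γ (newS Γ pstar σ N) z y).2 =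
              (h ++ [(σ h, y.2)], j + 1) := by
            simp only [app]
            rw [mem_append, upd, if_pos h2]
            rfl
          have e2 : N - (j + 1) = n := by omega
          simp only [U]
          rw [e1]
          simp only [e2]
          rfl
        have e3 : Pop Γ (newS Γ pstar σ N) U z =
            ∑ y, Γ.q z.1 (σ h) y * (GG Γ σ n (app Γ σ (z.1, h) y) - n * c) := by
          unfold Pop
          simp_rw [e]
          rfl
        rw [e3]
        simp_rw [mul_sub]
        rw [Finset.sum_sub_distrib, ← Finset.sum_mul, Γ.q_sum, one_mul]
        rfl
      · have hn0 : n = 0 := by omega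
        have e0 : Pop Γ σ (GG Γ σ n) (z.1, h) - n * c = 0 := by
          rw [hn0]; simp [Pop, GG]
        rw [e0]
        refine Pop_mono_of Γ _ fun y hy => ?_
        have e1 : mem Γ pstar σ N (app Γ (newS Γ pstar σ N) z y).2 =
            (rep Γ pstar σ (TT Γ pstar σ (h ++ [(σ h, y.2)])), 0) := by
          simp only [app]
          rw [mem_append, upd, if_neg h2]
          rfl
        have hr2 := (inv_reach Γ pstar σ N hN k hk _ (Reach.next _ _ hz hy)).1
        rw [e1] at hr2
        have h3 := hNev _ k _ hk hr2
        simp only [U]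
        rw [e1]
        simp only [Nat.sub_zero]
        rw [one_div, le_inv_mul_iff₀ hN'] at h3
        rw [← hc] at h3
        linarith
    have hae := drift Γ (newS Γ pstar σ N) k U _ hU c (ε / 3) hε3 hd
    have h4 : ∫ _x, (c - 2 * (ε / 3)) ∂muU ≤ Lk Γ (newS Γ pstar σ N) k := by
      refine integral_mono_ae (integrable_const _) ?_ hae
      exact bdd_int ((measurable_liminf_avg Γ _).comp measurable_prodMk_left)
        (fun x => liminf_abs Γ _ _)
    have h5 : ∫ _x, (c - 2 * (ε / 3)) ∂muU = c - 2 * (ε / 3) := by simp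
    rw [h5] at h4
    linarith
  rw [pay_eq Γ _ _ hps.1, pay_eq Γ _ _ hps.1, ge_iff_le]
  have h6 : ∑ k, pstar k * Lk Γ σ k - ε = ∑ k, pstar k * (Lk Γ σ k - ε) := by
    simp_rw [mul_sub]
    rw [Finset.sum_sub_distrib, ← Finset.sum_mul, hps.2, one_mul]
  rw [h6]
  refine Finset.sum_le_sum fun k _ => ?_
  rcases (hps.1 k).eq_or_lt with h0 | h0
  · simp [← h0]
  · exact mul_le_mul_of_nonneg_left (main k h0) h0.le

end PomdpPaper
end
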